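/- Assume the Reissner–Nordström radial setup stated in the context, and for ω ∈ (0, m) set k = M·m²/√(m² − ω²). Let p ≥ 2 be an integer. There exists C > 0, depending only on p, M, 𝐞, m, such that for every sufficiently large integer L there exists a real number D with |D| ≤ C·L³ such that the following holds: for every ω ∈ (m − L^{−p}, m) and every pair of real numbers s_II < s_III satisfying V(ω, L, s_II) = V(ω, L, s_III) = 0, V(ω, L, s) < 0 for all s ∈ (s_II, s_III), V(ω, L, s) > 0 for all s > s_III, and V(ω, L, s) > 0 for all s in some interval (s_II − η, s_II) with η > 0, the quantity k̃ defined by π·k̃ = ∫_{s_II}^{s_III} √(−V(ω, L, s)) ds satisfies |k̃ − k − D| ≤ C·L²·k⁻¹. In particular D depends on L but not on ω. -/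

import Mathlib

open MeasureTheory Filter Set

/-- The radial Klein–Gordon potential on a subextremal Reissner–Nordström exterior,
expressed in the tortoise-type coordinate `s` via the inverse map `rofs = r(s)`. -/
noncomputable def Vpot (M m E : ℝ) (rofs : ℝ → ℝ) (ω : ℝ) (L : ℕ) (s : ℝ) : ℝ :=
  -ω ^ 2 + (1 - 2 * M / rofs s + E ^ 2 / rofs s ^ 2) *
    (m ^ 2 + ((L : ℝ) * ((L : ℝ) + 1)) / rofs s ^ 2 +
      (2 * M * rofs s - 2 * E ^ 2) / rofs s ^ 4)

/-- `u` is weakly outgoing: `u ∼ c·e^{−iωs}` (with its derivative) as `s → −∞`, and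
`u` together with `u'` decays exponentially as `s → +∞`. -/
def WeaklyOutgoing (ω : ℝ) (u : ℝ → ℂ) : Prop :=
  (∃ c : ℂ,
    Filter.Tendsto (fun s : ℝ => u s - c * Complex.exp (-Complex.I * (ω : ℂ) * (s : ℂ)))
      Filter.atBot (nhds 0) ∧
    Filter.Tendsto (fun s : ℝ =>
        deriv u s + Complex.I * (ω : ℂ) * c * Complex.exp (-Complex.I * (ω : ℂ) * (s : ℂ)))
      Filter.atBot (nhds 0)) ∧
  ∃ ε : ℝ, 0 < ε ∧
    Filter.Tendsto (fun s : ℝ => Real.exp (ε * s) * (‖u s‖ + ‖deriv u s‖))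
      Filter.atTop (nhds 0)
lemma sqrt_sub_sqrt_le_div {x y : ℝ} (h : x ≤ y) :
    Real.sqrt y - Real.sqrt x ≤ (y - x) / Real.sqrt y := by
  rcases le_or_gt y 0 with hy | hy
  · rw [Real.sqrt_eq_zero_of_nonpos hy, Real.sqrt_eq_zero_of_nonpos (h.trans hy)]
    simp
  · have hp := Real.sqrt_pos.mpr hy
    rw [le_div_iff₀ hp]
    have h1 := Real.mul_self_sqrt hy.le
    have h2 : x ≤ Real.sqrt x * Real.sqrt y := by
      rcases le_or_gt x 0 with hx | hx
      · exact hx.trans (by positivity)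
      · calc x = Real.sqrt x * Real.sqrt x := (Real.mul_self_sqrt hx.le).symm
          _ ≤ _ := by gcongr
    nlinarith

/-- The Coulomb phase integral. -/
lemma coulomb_phase_integral {d : ℝ} (hd : 0 < d) :
    IntegrableOn (fun y => Real.sqrt (y - d) / y ^ 2) (Ioi 0) ∧
      ∫ y in Ioi 0, Real.sqrt (y - d) / y ^ 2 = Real.pi / (2 * Real.sqrt d) := by
  set P : ℝ → ℝ := fun y => -(Real.sqrt (y - d) / y) +
    1 / Real.sqrt d * Real.arctan (Real.sqrt (y - d) / Real.sqrt d) with hP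
  have hsd := Real.sqrt_pos.mpr hd
  have hcont : ContinuousWithinAt P (Ici d) d := by
    apply ContinuousAt.continuousWithinAt
    have : d ≠ 0 := hd.ne'
    simp only [hP]
    fun_prop (disch := assumption)
  have hder : ∀ y ∈ Ioi d, HasDerivAt P (Real.sqrt (y - d) / y ^ 2) y := by
    intro y hy
    have hy' : 0 < y - d := sub_pos.mpr hy
    have hy0 : 0 < y := by linarith
    have hs := Real.sqrt_pos.mpr hy'
    have h1 : HasDerivAt (fun y => Real.sqrt (y - d)) (1 / (2 * Real.sqrt (y - d))) y :=
      ((hasDerivAt_id y).sub_const d).sqrt hy'.ne'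
    have h2 := (h1.div (hasDerivAt_id y) hy0.ne').neg
    have h3 := ((h1.div_const (Real.sqrt d)).arctan).const_mul (1 / Real.sqrt d)
    refine (h2.add h3).congr_deriv ?_
    have e1 := Real.sq_sqrt hy'.le
    have e2 := Real.sq_sqrt hd.le
    have e3 : 1 + (Real.sqrt (y - d) / Real.sqrt d) ^ 2 = y / d := by
      rw [div_pow, e1, e2]; field_simp; ring
    rw [e3]
    simp only [id]
    field_simp
    rw [e1, e2]
    ring
  have hnn : ∀ y ∈ Ioi d, 0 ≤ Real.sqrt (y - d) / y ^ 2 := fun y _ => by positivity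
  have hlim : Tendsto P atTop (nhds (Real.pi / (2 * Real.sqrt d))) := by
    have hinf : Tendsto (fun y : ℝ => Real.sqrt (y - d)) atTop atTop :=
      Real.tendsto_sqrt_atTop.comp (tendsto_atTop_add_const_right _ (-d) tendsto_id)
    have h1 : Tendsto (fun y : ℝ => Real.sqrt (y - d) / y) atTop (nhds 0) := by
      have hb : Tendsto (fun y : ℝ => (Real.sqrt y)⁻¹) atTop (nhds 0) :=
        tendsto_inv_atTop_zero.comp Real.tendsto_sqrt_atTop
      refine tendsto_of_tendsto_of_tendsto_of_le_of_le' tendsto_const_nhds hb ?_ ?_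
      · filter_upwards [eventually_gt_atTop 0] with y hy
        positivity
      · filter_upwards [eventually_gt_atTop 0] with y hy
        have hs := Real.sqrt_pos.mpr hy
        rw [div_le_iff₀ hy]
        calc Real.sqrt (y - d) ≤ Real.sqrt y := Real.sqrt_le_sqrt (by linarith)
          _ = (Real.sqrt y)⁻¹ * (Real.sqrt y * Real.sqrt y) := by field_simp
          _ = _ := by rw [Real.mul_self_sqrt hy.le]
    have h2 : Tendsto (fun y : ℝ => Real.arctan (Real.sqrt (y - d) / Real.sqrt d)) atTop
        (nhds (Real.pi / 2)) :=
      (tendsto_nhds_of_tendsto_nhdsWithin Real.tendsto_arctan_atTop).comp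
        (hinf.atTop_div_const hsd)
    have h3 := h1.neg.add (h2.const_mul (1 / Real.sqrt d))
    convert h3 using 2
    field_simp
    ring
  have hI := integrableOn_Ioi_deriv_of_nonneg hcont hder hnn hlim
  have hE := integral_Ioi_of_hasDerivAt_of_nonneg hcont hder hnn hlim
  have hPd : P d = 0 := by simp [hP]
  have hz : ∀ y ∈ Ioi (0 : ℝ) \ Ioi d, Real.sqrt (y - d) / y ^ 2 = 0 := by
    intro y hy
    have : y ≤ d := not_lt.mp hy.2
    rw [Real.sqrt_eq_zero_of_nonpos (by linarith), zero_div]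
  have hsub : Ioi d ⊆ Ioi (0 : ℝ) := Ioi_subset_Ioi hd.le
  refine ⟨?_, ?_⟩
  · exact hI.of_forall_sdiff_eq_zero measurableSet_Ioi hz
  · rw [setIntegral_eq_of_subset_of_forall_sdiff_eq_zero measurableSet_Ioi hsub hz, hE, hPd,
      sub_zero]

lemma integrableOn_Ioc_and_integral_of_deriv {g g' : ℝ → ℝ} {a b : ℝ} (hab : a ≤ b)
    (hc : Continuous g) (hd : ∀ y ∈ Ioo a b, HasDerivAt g (g' y) y)
    (hn : ∀ y ∈ Ioo a b, 0 ≤ g' y) :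
    IntegrableOn g' (Ioc a b) ∧ ∫ y in Ioc a b, g' y = g b - g a := by
  have hI := intervalIntegral.integrableOn_deriv_of_nonneg hc.continuousOn hd hn
  refine ⟨hI, ?_⟩
  rw [← intervalIntegral.integral_of_le hab]
  exact intervalIntegral.integral_eq_sub_of_hasDeriv_right_of_le hab hc.continuousOn
    (fun y hy => (hd y hy).hasDerivWithinAt)
    ((intervalIntegrable_iff_integrableOn_Ioc_of_le hab).mpr hI)

lemma integral_Ioc_one_div_sqrt_sub_left {a b : ℝ} (hab : a ≤ b) :
    IntegrableOn (fun y => 1 / Real.sqrt (y - a)) (Ioc a b) ∧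
      ∫ y in Ioc a b, 1 / Real.sqrt (y - a) = 2 * Real.sqrt (b - a) := by
  have h := integrableOn_Ioc_and_integral_of_deriv (g := fun y => 2 * Real.sqrt (y - a))
    (g' := fun y => 1 / Real.sqrt (y - a)) hab (by fun_prop)
    (fun y hy => by
      have h1 := (((hasDerivAt_id y).sub_const a).sqrt (sub_pos.mpr hy.1).ne').const_mul 2
      refine h1.congr_deriv ?_
      have := Real.sqrt_pos.mpr (sub_pos.mpr hy.1)
      simp only [id]
      field_simp)
    (fun y _ => by positivity)
  simpa using h

lemma integral_Ioc_one_div_sqrt_sub_right {a b : ℝ} (hab : a ≤ b) :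
    IntegrableOn (fun y => 1 / Real.sqrt (b - y)) (Ioc a b) ∧
      ∫ y in Ioc a b, 1 / Real.sqrt (b - y) = 2 * Real.sqrt (b - a) := by
  have h := integrableOn_Ioc_and_integral_of_deriv (g := fun y => -2 * Real.sqrt (b - y))
    (g' := fun y => 1 / Real.sqrt (b - y)) hab (by fun_prop)
    (fun y hy => by
      have h1 := (((hasDerivAt_id y).const_sub b).sqrt (sub_pos.mpr hy.2).ne').const_mul (-2)
      refine h1.congr_deriv ?_
      have := Real.sqrt_pos.mpr (sub_pos.mpr hy.2)
      simp only [id]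
      field_simp)
    (fun y _ => by positivity)
  simpa using h

lemma integral_Ioi_one_div_mul_sqrt {a : ℝ} (ha : 0 < a) :
    IntegrableOn (fun y => 1 / (y * Real.sqrt y)) (Ioi a) ∧
      ∫ y in Ioi a, 1 / (y * Real.sqrt y) = 2 / Real.sqrt a := by
  have hder : ∀ y ∈ Ici a, HasDerivAt (fun y => -2 / Real.sqrt y) (1 / (y * Real.sqrt y)) y := by
    intro y hy
    have hy0 : 0 < y := lt_of_lt_of_le ha hy
    have hs := Real.sqrt_pos.mpr hy0
    have h1 := ((hasDerivAt_id y).sqrt hy0.ne').inv hs.ne' |>.const_mul (-2)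
    have h2 : (fun y : ℝ => -2 / Real.sqrt y) = fun y => -2 * (Real.sqrt y)⁻¹ := by
      funext y; rw [div_eq_mul_inv]
    rw [h2]
    refine h1.congr_deriv ?_
    simp only [id]
    have e := Real.sq_sqrt hy0.le
    field_simp
    rw [e]
  have hn : ∀ y ∈ Ioi a, 0 ≤ 1 / (y * Real.sqrt y) := fun y hy => by
    have : 0 < y := lt_trans ha hy
    positivity
  have hl : Tendsto (fun y : ℝ => -2 / Real.sqrt y) atTop (nhds 0) :=
    Real.tendsto_sqrt_atTop.const_div_atTop (-2)
  refine ⟨integrableOn_Ioi_deriv_of_nonneg' hder hn hl, ?_⟩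
  rw [integral_Ioi_of_hasDerivAt_of_nonneg' hder hn hl]
  ring

lemma phase_diff_le_near {y v d h C₁ C₂ : ℝ} (hy : 0 < y) (hvy : v ≤ y)
    (hd : 0 ≤ d) (hv1 : y - v ≤ C₁ * y ^ 2) (hh : 1 ≤ h) (hh2 : h ≤ 1 + C₂ * y) :
    |(Real.sqrt (v - d) * h - Real.sqrt (y - d)) - (Real.sqrt v * h - Real.sqrt y)| / y ^ 2 ≤
      (C₁ + C₂) * (1 / Real.sqrt y) + C₁ * (1 / Real.sqrt (y - d)) := by
  have hs := Real.sqrt_pos.mpr hy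
  have a1 : Real.sqrt (y - d) - Real.sqrt (v - d) ≤ C₁ * y ^ 2 / Real.sqrt (y - d) :=
    (sqrt_sub_sqrt_le_div (by linarith)).trans (by gcongr; linarith)
  have a2 : Real.sqrt (v - d) ≤ Real.sqrt (y - d) := Real.sqrt_le_sqrt (by linarith)
  have b1 : Real.sqrt y - Real.sqrt v ≤ C₁ * y ^ 2 / Real.sqrt y :=
    (sqrt_sub_sqrt_le_div hvy).trans (by gcongr)
  have b2 : Real.sqrt v ≤ Real.sqrt y := Real.sqrt_le_sqrt hvy
  have c0 : 0 ≤ Real.sqrt (v - d) := Real.sqrt_nonneg _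
  have c1 : Real.sqrt (v - d) ≤ Real.sqrt v := Real.sqrt_le_sqrt (by linarith)
  have c2 : (h - 1) * (Real.sqrt v - Real.sqrt (v - d)) ≤ C₂ * y ^ 2 / Real.sqrt y := by
    have e : C₂ * y ^ 2 / Real.sqrt y = C₂ * y * Real.sqrt y := by
      have := Real.mul_self_sqrt hy.le
      rw [div_eq_iff hs.ne', mul_assoc, this]; ring
    rw [e]
    apply mul_le_mul <;> linarith
  have c3 : 0 ≤ (h - 1) * (Real.sqrt v - Real.sqrt (v - d)) :=
    mul_nonneg (by linarith) (by linarith)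
  have e : ((C₁ + C₂) * (1 / Real.sqrt y) + C₁ * (1 / Real.sqrt (y - d))) * y ^ 2 =
      C₁ * y ^ 2 / Real.sqrt y + C₂ * y ^ 2 / Real.sqrt y + C₁ * y ^ 2 / Real.sqrt (y - d) := by
    ring
  rw [div_le_iff₀ (by positivity), e, abs_le]
  constructor <;> nlinarith

set_option maxHeartbeats 800000 in
lemma phase_diff_le_mid {y v d h C₁ C₂ : ℝ} (hy : 0 < y) (hvy : v ≤ y)
    (hv2 : y / 2 ≤ v) (hd : 0 ≤ d) (hdy : 4 * d < y) (hv1 : y - v ≤ C₁ * y ^ 2)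
    (hC₁ : 0 ≤ C₁) (hC₂ : 0 ≤ C₂) (hh : 1 ≤ h) (hh2 : h ≤ 1 + C₂ * y) :
    |(Real.sqrt (v - d) * h - Real.sqrt (y - d)) - (Real.sqrt v * h - Real.sqrt y)| / y ^ 2 ≤
      (6 * C₁ + 2 * C₂) * (d * (1 / (y * Real.sqrt y))) := by
  obtain ⟨p, hp⟩ : ∃ p, p = Real.sqrt y := ⟨_, rfl⟩
  obtain ⟨q, hq⟩ : ∃ q, q = Real.sqrt (y - d) := ⟨_, rfl⟩
  obtain ⟨r, hr⟩ : ∃ r, r = Real.sqrt v := ⟨_, rfl⟩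
  obtain ⟨s, hs⟩ : ∃ s, s = Real.sqrt (v - d) := ⟨_, rfl⟩
  have p0 : 0 < p := hp ▸ Real.sqrt_pos.mpr hy
  have q0 : 0 ≤ q := hq ▸ Real.sqrt_nonneg _
  have r0 : 0 ≤ r := hr ▸ Real.sqrt_nonneg _
  have s0 : 0 ≤ s := hs ▸ Real.sqrt_nonneg _
  have p2 : p ^ 2 = y := hp ▸ Real.sq_sqrt hy.le
  have q2 : q ^ 2 = y - d := hq ▸ Real.sq_sqrt (by linarith)
  have r2 : r ^ 2 = v := hr ▸ Real.sq_sqrt (by linarith)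
  have s2 : s ^ 2 = v - d := hs ▸ Real.sq_sqrt (by linarith)
  have hqp : p / 2 ≤ q := by
    rw [hq]; apply Real.le_sqrt_of_sq_le; nlinarith
  have hrp : p / 2 ≤ r := by
    rw [hr]; apply Real.le_sqrt_of_sq_le; nlinarith
  have q1 : 0 < q := by linarith
  have r1 : 0 < r := by linarith
  have hsr : s ≤ r := by rw [hs, hr]; exact Real.sqrt_le_sqrt (by linarith)
  have hrp' : r ≤ p := by rw [hr, hp]; exact Real.sqrt_le_sqrt hvy
  have hsq' : s ≤ q := by rw [hs, hq]; exact Real.sqrt_le_sqrt (by linarith)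
  have a1 : p - r ≤ C₁ * y ^ 2 / p := by
    rw [hp, hr]
    exact (sqrt_sub_sqrt_le_div hvy).trans (by gcongr)
  have a2 : q - s ≤ 2 * (C₁ * y ^ 2 / p) := by
    rw [hq, hs]
    refine (sqrt_sub_sqrt_le_div (by linarith)).trans ?_
    rw [← hq, div_le_iff₀ q1]
    have : C₁ * y ^ 2 = C₁ * y ^ 2 / p * p := by field_simp
    have h3 : 0 ≤ C₁ * y ^ 2 / p := by positivity
    nlinarith
  have key : (r - s) - (p - q) = d * ((p + q) - (r + s)) / ((r + s) * (p + q)) := by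
    have h1 : (r - s) * (r + s) = d := by nlinarith
    have h2 : (p - q) * (p + q) = d := by nlinarith
    rw [eq_div_iff (by positivity)]
    linear_combination (p + q) * h1 - (r + s) * h2
  have k0 : 0 ≤ (r - s) - (p - q) := by
    rw [key]
    apply div_nonneg
    · exact mul_nonneg hd (by linarith)
    · positivity
  have k1 : (r - s) - (p - q) ≤ 6 * C₁ * (d * y ^ 2 / p ^ 3) := by
    rw [key, div_le_iff₀ (by positivity)]
    have h1 : p ^ 2 / 2 ≤ (r + s) * (p + q) := by nlinarith
    have h3 : 0 ≤ 6 * C₁ * (d * y ^ 2 / p ^ 3) := by positivity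
    calc d * ((p + q) - (r + s)) ≤ d * (3 * (C₁ * y ^ 2 / p)) := by gcongr; linarith
      _ = 6 * C₁ * (d * y ^ 2 / p ^ 3) * (p ^ 2 / 2) := by field_simp; ring
      _ ≤ _ := by gcongr
  have k2 : r - s ≤ 2 * d / p := by
    rw [le_div_iff₀ p0]
    nlinarith
  have k3 : (h - 1) * (r - s) ≤ 2 * C₂ * (d * y ^ 2 / p ^ 3) := by
    calc (h - 1) * (r - s) ≤ (C₂ * y) * (2 * d / p) := by
          apply mul_le_mul (by linarith) k2 (by linarith) (by positivity)
      _ = 2 * C₂ * (d * y ^ 2 / p ^ 3) := by rw [← p2]; field_simp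
  have k4 : 0 ≤ (h - 1) * (r - s) := mul_nonneg (by linarith) (by linarith)
  have e : (6 * C₁ + 2 * C₂) * (d * (1 / (y * p))) * y ^ 2 =
      6 * C₁ * (d * y ^ 2 / p ^ 3) + 2 * C₂ * (d * y ^ 2 / p ^ 3) := by
    rw [← p2]; field_simp
  rw [← hp, ← hq, ← hr, ← hs, div_le_iff₀ (by positivity), e, abs_le]
  constructor <;> linarith

lemma phase_diff_le_far {y v d h A y₀ z ρ : ℝ} (hy₀ : 0 < y₀) (hy : y₀ < y) (hyz : y < z)
    (hd : 0 ≤ d) (hρ : 0 < ρ) (hv : ρ * (z - y) ≤ v) (hh : 1 ≤ h) (hh2 : h ≤ A) :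
    |(Real.sqrt (v - d) * h - Real.sqrt (y - d)) - (Real.sqrt v * h - Real.sqrt y)| / y ^ 2 ≤
      1 / y₀ * (d * (1 / (y * Real.sqrt y))) +
        A / (y₀ ^ 2 * Real.sqrt ρ) * (d * (1 / Real.sqrt (z - y))) := by
  have y1 : 0 < y := hy₀.trans hy
  have hs := Real.sqrt_pos.mpr y1
  have hz := Real.sqrt_pos.mpr (sub_pos.mpr hyz)
  have hr := Real.sqrt_pos.mpr hρ
  have a1 : Real.sqrt y - Real.sqrt (y - d) ≤ d / Real.sqrt y :=
    (sqrt_sub_sqrt_le_div (by linarith)).trans (by rw [sub_sub_cancel])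
  have a2 : Real.sqrt (y - d) ≤ Real.sqrt y := Real.sqrt_le_sqrt (by linarith)
  have b1 : Real.sqrt v - Real.sqrt (v - d) ≤ d / (Real.sqrt ρ * Real.sqrt (z - y)) := by
    refine (sqrt_sub_sqrt_le_div (by linarith)).trans ?_
    rw [sub_sub_cancel, ← Real.sqrt_mul hρ.le]
    have := mul_pos hρ (sub_pos.mpr hyz)
    gcongr
  have b2 : Real.sqrt (v - d) ≤ Real.sqrt v := Real.sqrt_le_sqrt (by linarith)
  have c1 : h * (Real.sqrt v - Real.sqrt (v - d)) ≤
      A * (d / (Real.sqrt ρ * Real.sqrt (z - y))) :=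
    mul_le_mul hh2 b1 (by linarith) (by linarith)
  have c2 : 0 ≤ h * (Real.sqrt v - Real.sqrt (v - d)) := mul_nonneg (by linarith) (by linarith)
  have hnum : |(Real.sqrt (v - d) * h - Real.sqrt (y - d)) - (Real.sqrt v * h - Real.sqrt y)| ≤
      d / Real.sqrt y + A * (d / (Real.sqrt ρ * Real.sqrt (z - y))) := by
    rw [abs_le]
    constructor <;> nlinarith
  calc _ ≤ (d / Real.sqrt y + A * (d / (Real.sqrt ρ * Real.sqrt (z - y)))) / y ^ 2 := by gcongr
    _ = 1 / y * (d * (1 / (y * Real.sqrt y))) +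
        A / (y ^ 2 * Real.sqrt ρ) * (d * (1 / Real.sqrt (z - y))) := by field_simp
    _ ≤ _ := by
      have : 0 ≤ A := by linarith
      gcongr

lemma phase_diff_le_beyond {y d h y₀ : ℝ} (hy₀ : 0 < y₀) (hy : y₀ < y) (hd : 0 ≤ d) :
    |(Real.sqrt (0 - d) * h - Real.sqrt (y - d)) - (Real.sqrt 0 * h - Real.sqrt y)| / y ^ 2 ≤
      1 / y₀ * (d * (1 / (y * Real.sqrt y))) := by
  have y1 : 0 < y := hy₀.trans hy
  have hs := Real.sqrt_pos.mpr y1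
  have a1 : Real.sqrt y - Real.sqrt (y - d) ≤ d / Real.sqrt y :=
    (sqrt_sub_sqrt_le_div (by linarith)).trans (by rw [sub_sub_cancel])
  have a2 : Real.sqrt (y - d) ≤ Real.sqrt y := Real.sqrt_le_sqrt (by linarith)
  rw [Real.sqrt_eq_zero_of_nonpos (by linarith : 0 - d ≤ 0), Real.sqrt_zero]
  have hnum : |0 * h - Real.sqrt (y - d) - (0 * h - Real.sqrt y)| ≤ d / Real.sqrt y := by
    rw [abs_le]
    constructor <;> nlinarith [Real.sqrt_nonneg (y - d), div_nonneg hd hs.le]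
  calc _ ≤ (d / Real.sqrt y) / y ^ 2 := by gcongr
    _ = 1 / y * (d * (1 / (y * Real.sqrt y))) := by field_simp
    _ ≤ _ := by gcongr

/-- `f` is integrable on `(0, ∞)` with integral `I`. -/
def HasPosIntegral (f : ℝ → ℝ) (I : ℝ) : Prop :=
  IntegrableOn f (Ioi 0) ∧ ∫ y in Ioi 0, f y = I

lemma HasPosIntegral.add {f g : ℝ → ℝ} {I J : ℝ} (hf : HasPosIntegral f I)
    (hg : HasPosIntegral g J) : HasPosIntegral (fun y => f y + g y) (I + J) :=
  ⟨hf.1.add hg.1, by rw [integral_add hf.1 hg.1, hf.2, hg.2]⟩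

lemma HasPosIntegral.const_mul {f : ℝ → ℝ} {I : ℝ} (hf : HasPosIntegral f I) (c : ℝ) :
    HasPosIntegral (fun y => c * f y) (c * I) :=
  ⟨hf.1.const_mul c, by rw [integral_const_mul, hf.2]⟩

lemma HasPosIntegral.indicator {f : ℝ → ℝ} {S : Set ℝ} {I : ℝ} (hS : MeasurableSet S)
    (hS0 : S ⊆ Ioi 0) (hf : IntegrableOn f S ∧ ∫ y in S, f y = I) :
    HasPosIntegral (S.indicator f) I := by
  refine ⟨(hf.1.integrable_indicator hS).integrableOn, ?_⟩
  rw [setIntegral_indicator hS, inter_eq_self_of_subset_right hS0, hf.2]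

lemma HasPosIntegral.abs_integral_le {f g : ℝ → ℝ} {I : ℝ} (hg : HasPosIntegral g I)
    (h : ∀ y, 0 < y → |f y| ≤ g y) : |∫ y in Ioi 0, f y| ≤ I := by
  rw [← hg.2]
  refine norm_integral_le_of_norm_le (f := f) hg.1 ?_
  filter_upwards [ae_restrict_mem measurableSet_Ioi] with y hy
  exact h y hy

lemma HasPosIntegral.integrableOn_of_le {f g : ℝ → ℝ} {I : ℝ} (hg : HasPosIntegral g I)
    (hf : Measurable f) (h : ∀ y, 0 < y → |f y| ≤ g y) : IntegrableOn f (Ioi 0) := by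
  refine hg.1.mono' hf.aestronglyMeasurable ?_
  filter_upwards [ae_restrict_mem measurableSet_Ioi] with y hy
  exact h y hy

set_option maxHeartbeats 2000000 in
/-- Asymptotics of a perturbed Coulomb phase integral as the energy parameter `d` tends to `0`,
uniformly over the perturbations `v` of the identity and `h` of the constant `1`. -/
theorem perturbed_phase_integral {C₁ C₂ Z ρ d₀ : ℝ} (hC₁ : 0 < C₁) (hC₂ : 0 ≤ C₂)
    (hZ : 0 < Z) (hρ : 0 < ρ) (hd₀ : 0 < d₀) :
    ∃ C : ℝ, 0 < C ∧ ∀ (z : ℝ) (v h : ℝ → ℝ), Measurable v → Measurable h → 1 ≤ C₁ * z → z ≤ Z →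
      (∀ y, 0 < y → y < z → v y ≤ y ∧ y - v y ≤ C₁ * y ^ 2 ∧ ρ * y * (z - y) ≤ v y ∧
        1 ≤ h y ∧ h y ≤ 1 + C₂ * y) →
      (∀ y, z ≤ y → v y = 0) →
      ∃ D : ℝ, |D| ≤ C ∧ ∀ d : ℝ, 0 < d → d ≤ d₀ →
        |(∫ y in Ioi 0, Real.sqrt (v y - d) * h y / y ^ 2) - Real.pi / (2 * Real.sqrt d) - D| ≤
          C * Real.sqrt d := by
  set y₀ : ℝ := 1 / (2 * C₁) with hy₀
  have hy₀p : 0 < y₀ := by positivity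
  set A : ℝ := 1 + C₂ * Z with hA
  have hAp : 1 ≤ A := by have := mul_nonneg hC₂ hZ.le; linarith
  set K₁ : ℝ := (C₁ + C₂) * (2 * Real.sqrt y₀) + A * (2 / Real.sqrt y₀) with hK₁
  set B : ℝ := A / (y₀ ^ 2 * Real.sqrt (ρ * y₀)) with hB
  set K₂ : ℝ := (C₁ + C₂) * 4 + C₁ * 4 + (6 * C₁ + 2 * C₂) +
    1 / y₀ * (Real.sqrt d₀ * (2 / Real.sqrt y₀)) + B * (Real.sqrt d₀ * (2 * Real.sqrt Z)) with hK₂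
  have hK₁p : 0 < K₁ := by positivity
  have hK₂p : 0 < K₂ := by positivity
  refine ⟨K₁ + K₂, by positivity, ?_⟩
  intro z v h hvm hhm hz1 hzZ hv hvz
  have hzy₀ : y₀ < z := by
    rw [hy₀, div_lt_iff₀ (by positivity)]
    nlinarith
  have hzp : 0 < z := hy₀p.trans hzy₀
  have hv0 : ∀ y, 0 < y → 0 ≤ v y ∧ v y ≤ y := by
    intro y hy
    rcases lt_or_ge y z with hyz | hyz
    · obtain ⟨h1, -, h3, -⟩ := hv y hy hyz
      exact ⟨le_trans (by have := sub_pos.mpr hyz; positivity) h3, h1⟩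
    · rw [hvz y hyz]; exact ⟨le_rfl, hy.le⟩
  have hhA : ∀ y, 0 < y → y < z → h y ≤ A := by
    intro y hy hyz
    refine (hv y hy hyz).2.2.2.2.trans ?_
    have := mul_le_mul_of_nonneg_left (hyz.le.trans hzZ) hC₂
    linarith
  have hsqrth : ∀ t, 0 ≤ t → ∀ y, 0 < y → |Real.sqrt (v y - t) * h y| ≤ A * Real.sqrt (y - t) := by
    intro t ht y hy
    rcases lt_or_ge y z with hyz | hyz
    · have h1 := (hv y hy hyz).2.2.2.1
      rw [abs_of_nonneg (mul_nonneg (Real.sqrt_nonneg _) (by linarith)), mul_comm]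
      exact mul_le_mul (hhA y hy hyz) (Real.sqrt_le_sqrt (by linarith [(hv0 y hy).2]))
        (Real.sqrt_nonneg _) (by linarith)
    · rw [hvz y hyz, Real.sqrt_eq_zero_of_nonpos (by linarith), zero_mul, abs_zero]
      positivity
  set f₀ : ℝ → ℝ := fun y => (Real.sqrt (v y) * h y - Real.sqrt y) / y ^ 2 with hf₀
  have hM₁ : HasPosIntegral (fun y => (C₁ + C₂) * (Ioc 0 y₀).indicator (fun y => 1 / Real.sqrt y) y
      + (A * (Ioi y₀).indicator (fun y => 1 / (y * Real.sqrt y)) y)) K₁ := by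
    refine HasPosIntegral.add (HasPosIntegral.const_mul (HasPosIntegral.indicator measurableSet_Ioc
      (fun y hy => hy.1) ?_) _) (HasPosIntegral.const_mul (HasPosIntegral.indicator
      measurableSet_Ioi (Ioi_subset_Ioi hy₀p.le) (integral_Ioi_one_div_mul_sqrt hy₀p)) _)
    simpa using integral_Ioc_one_div_sqrt_sub_left hy₀p.le
  have hf₀M : ∀ y, 0 < y → |f₀ y| ≤ (C₁ + C₂) * (Ioc 0 y₀).indicator (fun y => 1 / Real.sqrt y) y
      + (A * (Ioi y₀).indicator (fun y => 1 / (y * Real.sqrt y)) y) := by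
    intro y hy
    rw [hf₀, abs_div, abs_of_pos (by positivity : 0 < y ^ 2)]
    rcases le_or_gt y y₀ with hyy | hyy
    · obtain ⟨h1, h2, h3, h4, h5⟩ := hv y hy (hyy.trans_lt hzy₀)
      have := phase_diff_le_near hy h1 hy.le h2 h4 h5
      rw [indicator_of_mem (show y ∈ Ioc 0 y₀ from ⟨hy, hyy⟩),
        indicator_of_notMem (show y ∉ Ioi y₀ from not_lt.mpr hyy)]
      rw [Real.sqrt_eq_zero_of_nonpos (by linarith : v y - y ≤ 0), sub_self, Real.sqrt_zero] at this
      simpa [abs_sub_comm] using this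
    · rw [indicator_of_notMem (show y ∉ Ioc 0 y₀ from fun hc => absurd hc.2 (not_le.mpr hyy)),
        indicator_of_mem (show y ∈ Ioi y₀ from hyy)]
      have hs := Real.sqrt_pos.mpr hy
      have hn : |Real.sqrt (v y) * h y - Real.sqrt y| ≤ A * Real.sqrt y := by
        have h1 := hsqrth 0 le_rfl y hy
        rw [sub_zero, sub_zero] at h1
        have h2 : 0 ≤ Real.sqrt (v y) * h y := by
          rcases lt_or_ge y z with hyz | hyz
          · exact mul_nonneg (Real.sqrt_nonneg _) (by linarith [(hv y hy hyz).2.2.2.1])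
          · rw [hvz y hyz]; simp
        rw [abs_of_nonneg h2] at h1
        rw [abs_le]
        constructor <;> nlinarith
      rw [mul_zero, zero_add, div_le_iff₀ (by positivity)]
      refine hn.trans (le_of_eq ?_)
      have := Real.sq_sqrt hy.le
      field_simp
      rw [this]
  have hf₀I : IntegrableOn f₀ (Ioi 0) :=
    hM₁.integrableOn_of_le (by rw [hf₀]; fun_prop) hf₀M
  refine ⟨∫ y in Ioi 0, f₀ y, (hM₁.abs_integral_le hf₀M).trans (by linarith), ?_⟩
  intro d hd hdd₀
  have hsd := Real.sqrt_pos.mpr hd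
  obtain ⟨hn1, hn2⟩ := coulomb_phase_integral hd
  have hnP : HasPosIntegral (fun y => A * (Real.sqrt (y - d) / y ^ 2))
    (A * (Real.pi / (2 * Real.sqrt d))) := HasPosIntegral.const_mul ⟨hn1, hn2⟩ A
  have hwI : IntegrableOn (fun y => Real.sqrt (v y - d) * h y / y ^ 2) (Ioi 0) := by
    refine hnP.integrableOn_of_le (by fun_prop) ?_
    intro y hy
    rw [abs_div, abs_of_pos (by positivity : 0 < y ^ 2), ← mul_div_assoc]
    gcongr
    exact hsqrth d hd.le y hy
  have heq : (∫ y in Ioi 0, Real.sqrt (v y - d) * h y / y ^ 2) - Real.pi / (2 * Real.sqrt d) -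
      ∫ y in Ioi 0, f₀ y = ∫ y in Ioi 0, ((Real.sqrt (v y - d) * h y - Real.sqrt (y - d)) -
        (Real.sqrt (v y) * h y - Real.sqrt y)) / y ^ 2 := by
    rw [← hn2, ← integral_sub hwI hn1]
    refine (integral_sub (hwI.sub hn1) hf₀I).symm.trans ?_
    congr 1
    funext y
    simp only [hf₀, Pi.sub_apply]
    ring
  rw [heq]
  have h4d : (0 : ℝ) < 4 * d := by positivity
  have P1 : HasPosIntegral ((Ioc 0 (4 * d)).indicator (fun y => 1 / Real.sqrt y))
      (2 * Real.sqrt (4 * d)) := HasPosIntegral.indicator measurableSet_Ioc (fun y hy => hy.1)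
    (by simpa using integral_Ioc_one_div_sqrt_sub_left h4d.le)
  have P2 : HasPosIntegral ((Ioc d (4 * d)).indicator (fun y => 1 / Real.sqrt (y - d)))
      (2 * Real.sqrt (4 * d - d)) := HasPosIntegral.indicator measurableSet_Ioc
    (fun y hy => hd.trans hy.1) (integral_Ioc_one_div_sqrt_sub_left (by linarith))
  have P3 : HasPosIntegral ((Ioi (4 * d)).indicator (fun y => 1 / (y * Real.sqrt y)))
      (2 / Real.sqrt (4 * d)) := HasPosIntegral.indicator measurableSet_Ioi
    (Ioi_subset_Ioi h4d.le) (integral_Ioi_one_div_mul_sqrt h4d)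
  have P4 : HasPosIntegral ((Ioi y₀).indicator (fun y => 1 / (y * Real.sqrt y)))
      (2 / Real.sqrt y₀) := HasPosIntegral.indicator measurableSet_Ioi
    (Ioi_subset_Ioi hy₀p.le) (integral_Ioi_one_div_mul_sqrt hy₀p)
  have P5 : HasPosIntegral ((Ioc 0 z).indicator (fun y => 1 / Real.sqrt (z - y)))
      (2 * Real.sqrt z) := HasPosIntegral.indicator measurableSet_Ioc (fun y hy => hy.1)
    (by simpa using integral_Ioc_one_div_sqrt_sub_right hzp.le)
  have hM₂ := ((((P1.const_mul (C₁ + C₂)).add (P2.const_mul C₁)).add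
    ((P3.const_mul d).const_mul (6 * C₁ + 2 * C₂))).add ((P4.const_mul d).const_mul (1 / y₀))).add
    ((P5.const_mul d).const_mul B)
  have i1 : ∀ y, 0 ≤ (Ioc 0 (4 * d)).indicator (fun y => 1 / Real.sqrt y) y := fun y =>
    indicator_nonneg (fun _ _ => by positivity) y
  have i2 : ∀ y, 0 ≤ (Ioc d (4 * d)).indicator (fun y => 1 / Real.sqrt (y - d)) y := fun y =>
    indicator_nonneg (fun _ _ => by positivity) y
  have i3 : ∀ y, 0 ≤ (Ioi (4 * d)).indicator (fun y => 1 / (y * Real.sqrt y)) y := fun y =>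
    indicator_nonneg (fun x hx => by have : 0 < x := h4d.trans hx; positivity) y
  have i4 : ∀ y, 0 ≤ (Ioi y₀).indicator (fun y => 1 / (y * Real.sqrt y)) y := fun y =>
    indicator_nonneg (fun x hx => by have : 0 < x := hy₀p.trans hx; positivity) y
  have i5 : ∀ y, 0 ≤ (Ioc 0 z).indicator (fun y => 1 / Real.sqrt (z - y)) y := fun y =>
    indicator_nonneg (fun _ _ => by positivity) y
  have hBp : 0 < B := by positivity
  refine (hM₂.abs_integral_le ?_).trans ?_
  · intro y hy
    rw [abs_div, abs_of_pos (by positivity : 0 < y ^ 2)]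
    have j1 := mul_nonneg (by positivity : 0 ≤ C₁ + C₂) (i1 y)
    have j2 := mul_nonneg hC₁.le (i2 y)
    have j3 := mul_nonneg (by positivity : 0 ≤ 6 * C₁ + 2 * C₂) (mul_nonneg hd.le (i3 y))
    have j4 := mul_nonneg (by positivity : 0 ≤ 1 / y₀) (mul_nonneg hd.le (i4 y))
    have j5 := mul_nonneg hBp.le (mul_nonneg hd.le (i5 y))
    rcases le_or_gt y y₀ with hyy | hyy
    · obtain ⟨h1, h2, h3, h4, h5⟩ := hv y hy (hyy.trans_lt hzy₀)
      rcases le_or_gt y (4 * d) with hyd | hyd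
      · refine (phase_diff_le_near hy h1 hd.le h2 h4 h5).trans ?_
        have e1 : (Ioc 0 (4 * d)).indicator (fun y => 1 / Real.sqrt y) y = 1 / Real.sqrt y :=
          indicator_of_mem (show y ∈ Ioc 0 (4 * d) from ⟨hy, hyd⟩) _
        have e2 : (Ioc d (4 * d)).indicator (fun y => 1 / Real.sqrt (y - d)) y =
            1 / Real.sqrt (y - d) := by
          rcases le_or_gt y d with hyd' | hyd'
          · rw [indicator_of_notMem (fun hc => absurd hc.1 (not_lt.mpr hyd')),
              Real.sqrt_eq_zero_of_nonpos (by linarith), div_zero]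
          · exact indicator_of_mem (show y ∈ Ioc d (4 * d) from ⟨hyd', hyd⟩) _
        rw [e1, e2]
        linarith
      · have hv2 : y / 2 ≤ v y := by
          have : C₁ * y ≤ 1 / 2 := by
            rw [hy₀, le_div_iff₀ (by positivity)] at hyy
            linarith
          nlinarith
        refine (phase_diff_le_mid hy h1 hv2 hd.le hyd h2 hC₁.le hC₂ h4 h5).trans ?_
        have e3 : (Ioi (4 * d)).indicator (fun y => 1 / (y * Real.sqrt y)) y =
            1 / (y * Real.sqrt y) := indicator_of_mem (show y ∈ Ioi (4 * d) from hyd) _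
        rw [e3]
        linarith
    · have e4 : (Ioi y₀).indicator (fun y => 1 / (y * Real.sqrt y)) y =
          1 / (y * Real.sqrt y) := indicator_of_mem (show y ∈ Ioi y₀ from hyy) _
      rcases lt_or_ge y z with hyz | hyz
      · obtain ⟨h1, h2, h3, h4, h5⟩ := hv y hy hyz
        have hv3 : ρ * y₀ * (z - y) ≤ v y := by
          refine le_trans ?_ h3
          have := sub_pos.mpr hyz
          gcongr
        refine (phase_diff_le_far hy₀p hyy hyz hd.le (by positivity) hv3 h4
          (hhA y hy hyz)).trans ?_
        have e5 : (Ioc 0 z).indicator (fun y => 1 / Real.sqrt (z - y)) y =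
            1 / Real.sqrt (z - y) := indicator_of_mem (show y ∈ Ioc 0 z from ⟨hy, hyz.le⟩) _
        rw [e4, e5, ← hB]
        linarith
      · rw [hvz y hyz]
        refine (phase_diff_le_beyond hy₀p hyy hd.le).trans ?_
        rw [e4]
        linarith
  · have s4 : Real.sqrt (4 * d) = 2 * Real.sqrt d := by
      rw [Real.sqrt_mul (by norm_num), show (4 : ℝ) = 2 ^ 2 by norm_num,
        Real.sqrt_sq (by norm_num)]
    have s3 : Real.sqrt (4 * d - d) ≤ 2 * Real.sqrt d := by
      rw [← s4]; exact Real.sqrt_le_sqrt (by linarith)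
    have sd : d ≤ Real.sqrt d * Real.sqrt d₀ := by
      calc d = Real.sqrt d * Real.sqrt d := (Real.mul_self_sqrt hd.le).symm
        _ ≤ _ := by gcongr
    have sd2 : d * (2 / Real.sqrt (4 * d)) = Real.sqrt d := by
      rw [s4]
      have := Real.mul_self_sqrt hd.le
      field_simp
      nlinarith
    have sz : Real.sqrt z ≤ Real.sqrt Z := Real.sqrt_le_sqrt hzZ
    rw [sd2, s4]
    calc _ ≤ (C₁ + C₂) * (2 * (2 * Real.sqrt d)) + C₁ * (2 * (2 * Real.sqrt d)) +
          (6 * C₁ + 2 * C₂) * Real.sqrt d +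
          1 / y₀ * (Real.sqrt d * Real.sqrt d₀ * (2 / Real.sqrt y₀)) +
          B * (Real.sqrt d * Real.sqrt d₀ * (2 * Real.sqrt Z)) := by gcongr
      _ = K₂ * Real.sqrt d := by rw [hK₂]; ring
      _ ≤ _ := by gcongr; linarith

/-- The Reissner–Nordström metric coefficient as a function of `x = 1 / r`. -/
def rnLapse (M E x : ℝ) : ℝ := 1 - 2 * M * x + E ^ 2 * x ^ 2

/-- The depth of the Klein–Gordon potential below `m ^ 2`, as a function of `x = 1 / r`, with `Λ`
standing for `L (L + 1)`. -/
def rnWell (M m E Λ x : ℝ) : ℝ :=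
  m ^ 2 - rnLapse M E x * (m ^ 2 + Λ * x ^ 2 + 2 * M * x ^ 3 - 2 * E ^ 2 * x ^ 4)

lemma neg_Vpot_eq (M m E : ℝ) (rofs : ℝ → ℝ) (ω : ℝ) (L : ℕ) (s : ℝ) (h : rofs s ≠ 0) :
    -Vpot M m E rofs ω L s = rnWell M m E ((L : ℝ) * (L + 1)) (1 / rofs s) - (m ^ 2 - ω ^ 2) := by
  unfold Vpot rnWell rnLapse
  field_simp
  ring

lemma rnWell_concaveOn {M m E Λ c : ℝ} (hM : 0 < M) (hE : E ^ 2 ≤ M ^ 2) (hΛ : 0 ≤ Λ)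
    (hc : c ≤ Λ / 2) :
    ConcaveOn ℝ (Icc 0 (1 / (12 * M))) (fun x => rnWell M m E Λ x + c * x ^ 2) := by
  have hexp : (fun x => rnWell M m E Λ x + c * x ^ 2) = fun x =>
      2 * M * m ^ 2 * x + (c - m ^ 2 * E ^ 2 - Λ) * x ^ 2 + (2 * M * Λ - 2 * M) * x ^ 3 +
        (2 * E ^ 2 + 4 * M ^ 2 - Λ * E ^ 2) * x ^ 4 + (-6 * M * E ^ 2) * x ^ 5 +
        2 * E ^ 4 * x ^ 6 := by
    funext x; unfold rnWell rnLapse; ring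
  rw [hexp]
  refine concaveOn_of_hasDerivWithinAt2_nonpos (convex_Icc _ _) (by fun_prop)
    (f' := fun x => 2 * M * m ^ 2 + (c - m ^ 2 * E ^ 2 - Λ) * (2 * x) +
      (2 * M * Λ - 2 * M) * (3 * x ^ 2) + (2 * E ^ 2 + 4 * M ^ 2 - Λ * E ^ 2) * (4 * x ^ 3) +
      (-6 * M * E ^ 2) * (5 * x ^ 4) + 2 * E ^ 4 * (6 * x ^ 5))
    (f'' := fun x => (c - m ^ 2 * E ^ 2 - Λ) * 2 +
      (2 * M * Λ - 2 * M) * (6 * x) + (2 * E ^ 2 + 4 * M ^ 2 - Λ * E ^ 2) * (12 * x ^ 2) +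
      (-6 * M * E ^ 2) * (20 * x ^ 3) + 2 * E ^ 4 * (30 * x ^ 4)) ?_ ?_ ?_
  · intro x _
    apply HasDerivAt.hasDerivWithinAt
    have p : ∀ n : ℕ, HasDerivAt (fun x : ℝ => x ^ n) (n * x ^ (n - 1)) x := fun n =>
      hasDerivAt_pow n x
    have := ((((((hasDerivAt_id x).const_mul (2 * M * m ^ 2)).add
      ((p 2).const_mul (c - m ^ 2 * E ^ 2 - Λ))).add
      ((p 3).const_mul (2 * M * Λ - 2 * M))).add
      ((p 4).const_mul (2 * E ^ 2 + 4 * M ^ 2 - Λ * E ^ 2))).add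
      ((p 5).const_mul (-6 * M * E ^ 2))).add ((p 6).const_mul (2 * E ^ 4))
    refine this.congr_deriv ?_
    norm_num
  · intro x _
    apply HasDerivAt.hasDerivWithinAt
    have p : ∀ n : ℕ, HasDerivAt (fun x : ℝ => x ^ n) (n * x ^ (n - 1)) x := fun n =>
      hasDerivAt_pow n x
    have := ((((((((hasDerivAt_id x).const_mul 2).const_mul
      (c - m ^ 2 * E ^ 2 - Λ)).const_add (2 * M * m ^ 2))).add
      (((p 2).const_mul 3).const_mul (2 * M * Λ - 2 * M))).add
      (((p 3).const_mul 4).const_mul (2 * E ^ 2 + 4 * M ^ 2 - Λ * E ^ 2))).add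
      (((p 4).const_mul 5).const_mul (-6 * M * E ^ 2))).add
      (((p 5).const_mul 6).const_mul (2 * E ^ 4))
    refine this.congr_deriv ?_
    norm_num
    ring
  · intro x hx
    rw [interior_Icc] at hx
    have hx0 : 0 < x := hx.1
    have hx1 : 12 * (M * x) ≤ 1 := by
      have := hx.2.le
      rw [le_div_iff₀ (by positivity)] at this
      linarith
    have ht : 0 < M * x := by positivity
    have hEx : E ^ 2 * x ^ 2 ≤ M * x := by
      have : E ^ 2 * x ^ 2 ≤ M ^ 2 * x ^ 2 := by gcongr
      nlinarith
    have h1 : 0 ≤ Λ * (1 - 12 * (M * x)) := mul_nonneg hΛ (by linarith)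
    have h2 : 0 ≤ Λ * (E ^ 2 * x ^ 2) := by positivity
    have h3 : 0 ≤ m ^ 2 * E ^ 2 := by positivity
    have h4 : 0 ≤ (E ^ 2 * x ^ 2) * (2 * (M * x) - E ^ 2 * x ^ 2) :=
      mul_nonneg (by positivity) (by linarith)
    have h5 : 2 * (E ^ 2 * x ^ 2) + 4 * (M * x) ^ 2 ≤ M * x := by
      have : E ^ 2 * x ^ 2 ≤ M ^ 2 * x ^ 2 := by gcongr
      nlinarith
    nlinarith

lemma mul_le_mul_of_concaveOn_of_zero {w : ℝ → ℝ} {R x y : ℝ} (hw : ConcaveOn ℝ (Icc 0 R) w)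
    (hw0 : w 0 = 0) (hx : 0 ≤ x) (hxy : x ≤ y) (hy : 0 < y) (hyR : y ≤ R) :
    x * w y ≤ y * w x := by
  have h := hw.2 (show (0 : ℝ) ∈ Icc 0 R from ⟨le_rfl, hy.le.trans hyR⟩)
    (show y ∈ Icc 0 R from ⟨hy.le, hyR⟩)
    (show 0 ≤ 1 - x / y by rw [sub_nonneg, div_le_one hy]; exact hxy)
    (show 0 ≤ x / y by positivity) (by ring)
  simp only [smul_eq_mul, mul_zero, hw0, zero_add, div_mul_cancel₀ x hy.ne'] at h
  rw [div_mul_eq_mul_div, div_le_iff₀ hy] at h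
  linarith

lemma rnWell_zero (M m E Λ : ℝ) : rnWell M m E Λ 0 = 0 := by
  simp [rnWell, rnLapse]

lemma rnWell_bounds {M m E Λ x : ℝ} (hM : 0 < M) (hE : E ^ 2 ≤ M ^ 2)
    (hΛ : 1 + m ^ 2 * M ^ 2 ≤ Λ) (hx : 0 ≤ x) (hx1 : x ≤ 1 / (12 * M)) :
    rnWell M m E Λ x ≤ 2 * M * m ^ 2 * x ∧
      2 * M * m ^ 2 * x - rnWell M m E Λ x ≤ 2 * Λ * x ^ 2 := by
  rw [le_div_iff₀ (by positivity)] at hx1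
  have hMx : 0 ≤ M * x := by positivity
  have hEx : E ^ 2 * x ^ 2 ≤ M * x := by
    have : E ^ 2 * x ^ 2 ≤ M ^ 2 * x ^ 2 := by gcongr
    nlinarith
  have hEx0 : 0 ≤ E ^ 2 * x ^ 2 := by positivity
  have hf0 : 0 ≤ rnLapse M E x := by unfold rnLapse; nlinarith
  have hf1 : rnLapse M E x ≤ 1 := by unfold rnLapse; nlinarith
  have hΛ0 : 1 ≤ Λ := le_trans (by nlinarith [mul_nonneg (sq_nonneg m) (sq_nonneg M)]) hΛ
  have hmE : m ^ 2 * E ^ 2 ≤ m ^ 2 * M ^ 2 := by gcongr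
  have e : rnWell M m E Λ x = 2 * M * m ^ 2 * x -
      x ^ 2 * (m ^ 2 * E ^ 2 + rnLapse M E x * (Λ + 2 * (M * x) - 2 * (E ^ 2 * x ^ 2))) := by
    unfold rnWell rnLapse; ring
  have h1 : 0 ≤ Λ + 2 * (M * x) - 2 * (E ^ 2 * x ^ 2) := by linarith
  have h2 : rnLapse M E x * (Λ + 2 * (M * x) - 2 * (E ^ 2 * x ^ 2)) ≤ Λ + 1 := by
    refine (mul_le_of_le_one_left h1 hf1).trans ?_
    linarith
  have h3 := mul_nonneg hf0 h1
  rw [e]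
  constructor
  · have : 0 ≤ x ^ 2 * (m ^ 2 * E ^ 2 +
      rnLapse M E x * (Λ + 2 * (M * x) - 2 * (E ^ 2 * x ^ 2))) := by positivity
    linarith
  · have : x ^ 2 * (m ^ 2 * E ^ 2 +
      rnLapse M E x * (Λ + 2 * (M * x) - 2 * (E ^ 2 * x ^ 2))) ≤ x ^ 2 * (2 * Λ) := by
      gcongr; linarith
    linarith

lemma rnWell_neg {M m E Λ δ x : ℝ} (hM : 0 < M) (hm : 0 < m) (hΛ : 0 < Λ) (hδ : 0 < δ)
    (hf : δ ≤ rnLapse M E x) (hxE : E ^ 2 * x ≤ M) (hx : 4 * (M * m ^ 2) / δ / Λ ≤ x) :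
    rnWell M m E Λ x < 0 := by
  have hx0 : 0 < x := lt_of_lt_of_le (by positivity) hx
  rw [div_div, div_le_iff₀ (by positivity)] at hx
  have e : rnWell M m E Λ x = 2 * M * m ^ 2 * x -
      x ^ 2 * (m ^ 2 * E ^ 2 + rnLapse M E x * (Λ + 2 * x * (M - E ^ 2 * x))) := by
    unfold rnWell rnLapse; ring
  have h1 : Λ ≤ Λ + 2 * x * (M - E ^ 2 * x) := by
    have := mul_nonneg (by positivity : 0 ≤ 2 * x) (sub_nonneg.mpr hxE)
    linarith
  have h2 : δ * Λ ≤ rnLapse M E x * (Λ + 2 * x * (M - E ^ 2 * x)) :=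
    mul_le_mul hf h1 hΛ.le (hδ.le.trans hf)
  have h3 : x ^ 2 * (δ * Λ) ≤ x ^ 2 * (m ^ 2 * E ^ 2 +
      rnLapse M E x * (Λ + 2 * x * (M - E ^ 2 * x))) := by
    gcongr
    have : 0 ≤ m ^ 2 * E ^ 2 := by positivity
    linarith
  have h4 : x * (4 * (M * m ^ 2)) ≤ x * (x * (δ * Λ)) := by gcongr
  have h5 : 0 < M * m ^ 2 * x := by positivity
  rw [e]
  nlinarith

lemma rnWell_lt_of_lapse_small {M m E Λ δ X x y : ℝ} (hM : 0 < M)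
    (hΛ : 1 ≤ Λ) (hX : E ^ 2 * X < M) (hx : 0 < x) (hxy : x < y) (hyX : y < X)
    (hδ : δ ≤ 1 / 2)
    (hδ2 : δ * (2 * X + 6 * M * X ^ 2) ≤ (M - E ^ 2 * X) / (16 * M ^ 2))
    (hf : rnLapse M E x < δ) (hfy : 0 ≤ rnLapse M E y) :
    rnWell M m E Λ x < rnWell M m E Λ y := by
  have hy : 0 < y := hx.trans hxy
  have hX0 : 0 < X := hy.trans hyX
  have hd : 0 < y - x := sub_pos.mpr hxy
  have hg : 0 < M - E ^ 2 * X := sub_pos.mpr hX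
  have hEx : E ^ 2 * x ≤ E ^ 2 * X := by gcongr; linarith
  have hEy : E ^ 2 * y ≤ E ^ 2 * X := by gcongr
  have hx4 : 1 ≤ 4 * (M * x) := by
    have : 0 ≤ E ^ 2 * x ^ 2 := by positivity
    unfold rnLapse at hf
    linarith
  set U : ℝ → ℝ := fun t => m ^ 2 + Λ * t ^ 2 + 2 * M * t ^ 3 - 2 * E ^ 2 * t ^ 4 with hU
  have hfd : (y - x) * (2 * (M - E ^ 2 * X)) ≤ rnLapse M E x - rnLapse M E y := by
    have : rnLapse M E x - rnLapse M E y = (y - x) * (2 * M - E ^ 2 * x - E ^ 2 * y) := by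
      unfold rnLapse; ring
    rw [this]
    gcongr
    linarith
  have hUx : Λ / (16 * M ^ 2) ≤ U x := by
    have h1 : 0 ≤ 2 * x ^ 3 * (M - E ^ 2 * x) := mul_nonneg (by positivity) (by linarith)
    have h2 : Λ / (16 * M ^ 2) ≤ Λ * x ^ 2 := by
      rw [div_le_iff₀ (by positivity), mul_assoc]
      exact le_mul_of_one_le_right (by linarith) (by nlinarith)
    have h3 : U x = m ^ 2 + Λ * x ^ 2 + 2 * x ^ 3 * (M - E ^ 2 * x) := by rw [hU]; ring
    have := sq_nonneg m
    linarith
  have hUd : U y - U x ≤ (y - x) * (Λ * (2 * X + 6 * M * X ^ 2)) := by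
    have e : U y - U x = (y - x) * (Λ * (x + y) + 2 * M * (x ^ 2 + x * y + y ^ 2) -
        2 * E ^ 2 * ((x + y) * (x ^ 2 + y ^ 2))) := by rw [hU]; ring
    rw [e]
    gcongr
    have h1 : 0 ≤ 2 * E ^ 2 * ((x + y) * (x ^ 2 + y ^ 2)) := by positivity
    have h2 : x ^ 2 ≤ X ^ 2 := by gcongr; linarith
    have h3 : y ^ 2 ≤ X ^ 2 := by gcongr
    have h4 : x * y ≤ X ^ 2 := by nlinarith
    have h5 : Λ * (x + y) ≤ Λ * (2 * X) := by gcongr; linarith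
    have h6 : 2 * M * (x ^ 2 + x * y + y ^ 2) ≤ 6 * M * X ^ 2 := by nlinarith
    have h7 : 6 * M * X ^ 2 ≤ Λ * (6 * M * X ^ 2) := le_mul_of_one_le_left (by positivity) hΛ
    linarith
  have hfy2 : rnLapse M E y ≤ δ := by
    have : 0 ≤ (y - x) * (2 * (M - E ^ 2 * X)) := by positivity
    linarith
  have e : rnWell M m E Λ y - rnWell M m E Λ x =
      (rnLapse M E x - rnLapse M E y) * U x - rnLapse M E y * (U y - U x) := by
    unfold rnWell; rw [hU]; ring
  have hP : 0 < Λ / (16 * M ^ 2) := by positivity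
  have g1 : (y - x) * (2 * (M - E ^ 2 * X)) * (Λ / (16 * M ^ 2)) ≤
      (rnLapse M E x - rnLapse M E y) * U x := by
    apply mul_le_mul hfd hUx hP.le
    exact le_trans (by positivity) hfd
  have g2 : rnLapse M E y * (U y - U x) ≤
      δ * ((y - x) * (Λ * (2 * X + 6 * M * X ^ 2))) :=
    (mul_le_mul_of_nonneg_left hUd hfy).trans
      (mul_le_mul_of_nonneg_right hfy2 (by positivity))
  have g3 : δ * ((y - x) * (Λ * (2 * X + 6 * M * X ^ 2))) ≤
      (y - x) * Λ * ((M - E ^ 2 * X) / (16 * M ^ 2)) := by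
    calc _ = (y - x) * Λ * (δ * (2 * X + 6 * M * X ^ 2)) := by ring
      _ ≤ _ := by gcongr
  have g4 : (y - x) * (2 * (M - E ^ 2 * X)) * (Λ / (16 * M ^ 2)) =
      2 * ((y - x) * Λ * ((M - E ^ 2 * X) / (16 * M ^ 2))) := by ring
  have g5 : 0 < (y - x) * Λ * ((M - E ^ 2 * X) / (16 * M ^ 2)) := by positivity
  linarith

/-- The tortoise-type coordinate as a function of `r`. -/
noncomputable def rnTortoise (rm rp κ r : ℝ) : ℝ :=
  r + (2 * κ)⁻¹ * Real.log ((r - rm) * (r - rp))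

/-- The derivative of the tortoise-type coordinate, with `rm + rp = 2 * M`. -/
noncomputable def rnTortoiseDeriv (M rm rp κ r : ℝ) : ℝ :=
  1 + κ⁻¹ * ((r - M) / ((r - rm) * (r - rp)))

lemma hasDerivAt_rnTortoise {M rm rp κ r : ℝ} (hM : rm + rp = 2 * M) (hm : rm ≤ rp)
    (hκ : 0 < κ) (hr : rp < r) :
    HasDerivAt (rnTortoise rm rp κ) (rnTortoiseDeriv M rm rp κ r) r := by
  have h1 : 0 < r - rp := sub_pos.mpr hr
  have h2 : 0 < r - rm := by linarith
  have h := (hasDerivAt_id r).add ((((((hasDerivAt_id r).sub_const rm).mul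
    ((hasDerivAt_id r).sub_const rp))).log (mul_pos h2 h1).ne').const_mul (2 * κ)⁻¹)
  refine h.congr_deriv ?_
  unfold rnTortoiseDeriv
  simp only [id, Pi.mul_apply]
  have : M = (rm + rp) / 2 := by linarith
  rw [this]
  field_simp
  ring

lemma rnTortoise_strictMonoOn {rm rp κ : ℝ} (hm : rm ≤ rp) (hκ : 0 < κ) :
    StrictMonoOn (rnTortoise rm rp κ) (Ioi rp) := by
  intro x hx y hy hxy
  have hx' : 0 < x - rp := sub_pos.mpr hx
  unfold rnTortoise
  have : Real.log ((x - rm) * (x - rp)) ≤ Real.log ((y - rm) * (y - rp)) := by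
    apply Real.log_le_log
    · apply mul_pos <;> linarith
    · apply mul_le_mul <;> linarith
  have h2 := mul_le_mul_of_nonneg_left this (by positivity : 0 ≤ (2 * κ)⁻¹)
  linarith

lemma one_le_rnTortoiseDeriv {M rm rp κ r : ℝ} (hM : rm + rp = 2 * M) (hm : rm ≤ rp)
    (hκ : 0 < κ) (hr : rp < r) : 1 ≤ rnTortoiseDeriv M rm rp κ r := by
  have h1 : 0 < r - rp := sub_pos.mpr hr
  have h2 : 0 < r - rm := by linarith
  have h3 : 0 ≤ r - M := by linarith
  have : 0 ≤ κ⁻¹ * ((r - M) / ((r - rm) * (r - rp))) := by positivity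
  unfold rnTortoiseDeriv
  linarith

lemma rnTortoiseDeriv_le {M rm rp κ r : ℝ} (hM : rm + rp = 2 * M) (hM0 : 0 < M)
    (hm0 : 0 ≤ rm) (hm : rm ≤ rp) (hκ : 0 < κ) (hr : rp < r) (hr3 : 3 * M ≤ r) :
    rnTortoiseDeriv M rm rp κ r ≤ 1 + 2 * κ⁻¹ / r := by
  have h1 : 0 < r - rp := sub_pos.mpr hr
  have h2 : 0 < r - rm := by linarith
  have hr0 : 0 < r := by linarith
  have : (r - M) / ((r - rm) * (r - rp)) ≤ 2 / r := by
    rw [div_le_div_iff₀ (by positivity) hr0]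
    have : 0 ≤ rm * rp := mul_nonneg hm0 (hm0.trans hm)
    nlinarith
  unfold rnTortoiseDeriv
  have h3 := mul_le_mul_of_nonneg_left this (inv_pos.mpr hκ).le
  have e : κ⁻¹ * (2 / r) = 2 * κ⁻¹ / r := by ring
  linarith

/-- Change of variables from the tortoise-type coordinate `s` to `y = Λ / r`. -/
lemma integral_tortoise_eq {M rm rp κ Λ : ℝ} (hM : rm + rp = 2 * M) (hm : rm ≤ rp)
    (hp : 0 < rp) (hκ : 0 < κ) (hΛ : 0 < Λ) {rofs : ℝ → ℝ} (hr1 : ∀ s, rp < rofs s)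
    (hr2 : ∀ s, rnTortoise rm rp κ (rofs s) = s) {a b : ℝ} (hab : a < b) (F : ℝ → ℝ) :
    ∫ s in a..b, F s = ∫ y in Ioo (Λ / rofs b) (Λ / rofs a),
      rnTortoiseDeriv M rm rp κ (Λ / y) * (Λ / y ^ 2) * F (rnTortoise rm rp κ (Λ / y)) := by
  have hr0 : ∀ s, 0 < rofs s := fun s => hp.trans (hr1 s)
  have hmono := rnTortoise_strictMonoOn hm hκ
  have hrm : ∀ s t, rofs s < rofs t ↔ s < t := fun s t => by
    rw [← hmono.lt_iff_lt (hr1 s) (hr1 t), hr2, hr2]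
  have hy : ∀ y ∈ Ioo (Λ / rofs b) (Λ / rofs a), 0 < y ∧ rp < Λ / y := by
    intro y hy
    have h0 : 0 < y := lt_trans (by have := hr0 b; positivity) hy.1
    refine ⟨h0, (hr1 a).trans ?_⟩
    have := hy.2
    rw [lt_div_iff₀ (hr0 a)] at this
    rw [lt_div_iff₀ h0]
    linarith
  have himg : (fun y => rnTortoise rm rp κ (Λ / y)) '' Ioo (Λ / rofs b) (Λ / rofs a) =
      Ioo a b := by
    ext s
    constructor
    · rintro ⟨y, hyI, rfl⟩
      obtain ⟨h0, h1⟩ := hy y hyI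
      have e1 := hyI.1
      have e2 := hyI.2
      rw [div_lt_iff₀ (hr0 b)] at e1
      rw [lt_div_iff₀ (hr0 a)] at e2
      constructor
      · rw [← hr2 a]
        apply hmono (hr1 a) h1
        rw [lt_div_iff₀ h0]; linarith
      · rw [← hr2 b]
        apply hmono h1 (hr1 b)
        rw [div_lt_iff₀ h0]; linarith
    · intro hs
      refine ⟨Λ / rofs s, ⟨?_, ?_⟩, ?_⟩
      · have := (hrm s b).mpr hs.2
        have := hr0 s
        gcongr
      · have := (hrm a s).mpr hs.1
        have := hr0 a
        gcongr
      · simp only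
        rw [div_div_cancel₀ hΛ.ne', hr2]
  rw [intervalIntegral.integral_of_le hab.le, integral_Ioc_eq_integral_Ioo, ← himg,
    integral_image_eq_integral_abs_deriv_smul measurableSet_Ioo
      (f' := fun y => rnTortoiseDeriv M rm rp κ (Λ / y) * (-(Λ / y ^ 2)))]
  · refine setIntegral_congr_fun measurableSet_Ioo ?_
    intro y hyI
    obtain ⟨h0, h1⟩ := hy y hyI
    have := one_le_rnTortoiseDeriv hM hm hκ h1
    simp only [smul_eq_mul]
    rw [mul_neg, abs_neg, abs_of_nonneg (by positivity)]
  · intro y hyI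
    obtain ⟨h0, h1⟩ := hy y hyI
    apply HasDerivAt.hasDerivWithinAt
    refine HasDerivAt.comp y (hasDerivAt_rnTortoise hM hm hκ h1) ?_
    have h2 : HasDerivAt (fun y : ℝ => Λ * y⁻¹) (-(Λ / y ^ 2)) y :=
      ((hasDerivAt_inv h0.ne').const_mul Λ).congr_deriv (by ring)
    exact h2.congr_of_eventuallyEq (Eventually.of_forall fun t => div_eq_mul_inv Λ t)
  · intro y hyI y' hyI' heq
    obtain ⟨h0, h1⟩ := hy y hyI
    obtain ⟨h0', h1'⟩ := hy y' hyI'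
    have := hmono.injOn h1 h1' heq
    rw [div_eq_div_iff h0.ne' h0'.ne'] at this
    exact (mul_left_cancel₀ hΛ.ne' this).symm

lemma exists_rnWell_root {M m E Λ δ : ℝ} (hM : 0 < M) (hm : 0 < m) (hE : E ^ 2 ≤ M ^ 2)
    (hΛ : 1 + m ^ 2 * M ^ 2 ≤ Λ) (hδ : 0 < δ) (hδ1 : δ ≤ 1 / 2)
    (hK : 12 * M * (4 * (M * m ^ 2) / δ) ≤ Λ) :
    ∃ z, M * m ^ 2 ≤ z ∧ z ≤ 4 * (M * m ^ 2) / δ ∧ rnWell M m E Λ (z / Λ) = 0 := by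
  set a := M * m ^ 2 with ha
  set K := 4 * a / δ with hKdef
  have ha0 : 0 < a := by positivity
  have hΛ0 : 0 < Λ := lt_of_lt_of_le (by positivity) hΛ
  have haK : a ≤ K := by
    rw [hKdef, le_div_iff₀ hδ]; nlinarith
  have hKR : K / Λ ≤ 1 / (12 * M) := by
    rw [div_le_div_iff₀ hΛ0 (by positivity)]; linarith
  have haR : a / Λ ≤ 1 / (12 * M) := le_trans (by gcongr) hKR
  have h1 : 0 ≤ rnWell M m E Λ (a / Λ) := by
    have h := (rnWell_bounds hM hE hΛ (by positivity) haR).2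
    have e : 2 * M * m ^ 2 * (a / Λ) = 2 * Λ * (a / Λ) ^ 2 := by rw [ha]; field_simp
    linarith
  have h2 : rnWell M m E Λ (K / Λ) < 0 := by
    rw [le_div_iff₀ (by positivity)] at hKR
    have hp : 0 ≤ K / Λ := by positivity
    have hEx : E ^ 2 * (K / Λ) ≤ M ^ 2 * (K / Λ) := by gcongr
    refine rnWell_neg hM hm hΛ0 hδ ?_ ?_ le_rfl
    · unfold rnLapse
      have : 0 ≤ E ^ 2 * (K / Λ) ^ 2 := by positivity
      linarith
    · nlinarith
  have hc : ContinuousOn (fun z => rnWell M m E Λ (z / Λ)) (Icc a K) := by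
    unfold rnWell rnLapse; fun_prop
  obtain ⟨z, hz, hz0⟩ := intermediate_value_Icc' haK hc ⟨h2.le, h1⟩
  exact ⟨z, hz.1, hz.2, hz0⟩

/-- A zero of the potential to the left of which the potential is positive lies far from the
horizon. -/
lemma turning_point_far {M m E rm rp κ δ ω : ℝ} {L : ℕ} (hM0 : 0 < M) (hm0 : 0 < m)
    (hM : rm + rp = 2 * M) (hp : rm < rp) (hEr : rm * rp = E ^ 2) (hκ : 0 < κ)
    (hδ : 0 < δ) (hδ1 : δ ≤ 1 / 2)
    (hδ2 : δ * (2 * (1 / rp) + 6 * M * (1 / rp) ^ 2) ≤ (M - E ^ 2 * (1 / rp)) / (16 * M ^ 2))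
    (hΛ : 1 ≤ (L : ℝ) * (L + 1)) (hω : 0 < ω) (hωm : ω < m)
    {rofs : ℝ → ℝ} (hr1 : ∀ s, rp < rofs s) (hr2 : ∀ s, rnTortoise rm rp κ (rofs s) = s)
    {s η : ℝ} (hη : 0 < η) (hs : Vpot M m E rofs ω L s = 0)
    (hleft : ∀ t ∈ Ioo (s - η) s, 0 < Vpot M m E rofs ω L t) :
    1 / rofs s < 4 * (M * m ^ 2) / δ / ((L : ℝ) * (L + 1)) := by
  by_contra! hcon
  have hp0 : 0 < rp := by linarith
  have hr0 : ∀ s, 0 < rofs s := fun s => hp0.trans (hr1 s)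
  have hE2 : E ^ 2 * (1 / rp) = rm := by rw [← hEr]; field_simp
  have hmono := rnTortoise_strictMonoOn hp.le hκ
  have hX : ∀ t, 1 / rofs t < 1 / rp := fun t => by have := hr1 t; gcongr
  have hω2 : 0 < m ^ 2 - ω ^ 2 := by nlinarith
  have hu := neg_Vpot_eq M m E rofs ω L s (hr0 s).ne'
  have hf : rnLapse M E (1 / rofs s) < δ := by
    by_contra! hf
    have h1 : E ^ 2 * (1 / rofs s) ≤ M := by
      have : E ^ 2 * (1 / rofs s) ≤ E ^ 2 * (1 / rp) := by have := hX s; gcongr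
      linarith
    have := rnWell_neg hM0 hm0 (by linarith : 0 < (L : ℝ) * (L + 1)) hδ hf h1 hcon
    rw [hs] at hu
    linarith
  set t := s - η / 2 with ht
  have hts : t ∈ Ioo (s - η) s := ⟨by linarith, by linarith⟩
  have hlt : rofs t < rofs s := by
    rw [← hmono.lt_iff_lt (hr1 t) (hr1 s), hr2, hr2]; exact hts.2
  have hxy : 1 / rofs s < 1 / rofs t := by have := hr0 t; gcongr
  have hfy : 0 ≤ rnLapse M E (1 / rofs t) := by
    have e : rnLapse M E (1 / rofs t) = (1 - rm / rofs t) * (1 - rp / rofs t) := by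
      unfold rnLapse
      rw [← hEr, ← hM]; field_simp; ring
    rw [e]
    have := hr0 t
    have := hr1 t
    apply mul_nonneg <;> rw [sub_nonneg, div_le_one (by assumption)] <;> linarith
  have hlt2 := rnWell_lt_of_lapse_small (m := m) hM0 hΛ (by linarith : E ^ 2 * (1 / rp) < M)
    (by have := hr0 s; positivity) hxy (hX t) hδ1 hδ2 hf hfy
  have hu2 := neg_Vpot_eq M m E rofs ω L t (hr0 t).ne'
  have := hleft t hts
  rw [hs] at hu
  linarith

/-- The phase integral in the scaled variable `y = L (L + 1) / r`. -/
lemma phase_integral_eq_scaled {M m E rm rp κ ω z : ℝ} {L : ℕ} (hM0 : 0 < M) (hm0 : 0 < m)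
    (hM : rm + rp = 2 * M) (hp : rm < rp) (hEM : E ^ 2 ≤ M ^ 2) (hκ : 0 < κ)
    (hΛ : 1 ≤ (L : ℝ) * (L + 1)) (hω : 0 < ω) (hωm : ω < m)
    {rofs : ℝ → ℝ} (hr1 : ∀ s, rp < rofs s) (hr2 : ∀ s, rnTortoise rm rp κ (rofs s) = s)
    {sII sIII : ℝ} (hlt : sII < sIII) (hII : Vpot M m E rofs ω L sII = 0)
    (hIII : Vpot M m E rofs ω L sIII = 0)
    (hin : ∀ s ∈ Ioo sII sIII, Vpot M m E rofs ω L s < 0)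
    (hout : ∀ s, sIII < s → 0 < Vpot M m E rofs ω L s)
    (hz0 : 0 < z) (hz : rnWell M m E ((L : ℝ) * (L + 1)) (z / ((L : ℝ) * (L + 1))) = 0)
    (hzR : z / ((L : ℝ) * (L + 1)) ≤ 1 / (12 * M)) (hfar : 1 / rofs sII ≤ 1 / (12 * M)) :
    ∫ s in sII..sIII, Real.sqrt (-Vpot M m E rofs ω L s) =
      Real.sqrt (2 * (M * m ^ 2) * ((L : ℝ) * (L + 1))) * ∫ y in Ioi 0,
        Real.sqrt ((if y < z then rnWell M m E ((L : ℝ) * (L + 1)) (y / ((L : ℝ) * (L + 1))) *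
          ((L : ℝ) * (L + 1) / (2 * (M * m ^ 2))) else 0) -
            (L : ℝ) * (L + 1) * (m ^ 2 - ω ^ 2) / (2 * (M * m ^ 2))) *
          rnTortoiseDeriv M rm rp κ ((L : ℝ) * (L + 1) / y) / y ^ 2 := by
  have hV := fun s (hs : rofs s ≠ 0) => neg_Vpot_eq M m E rofs ω L s hs
  generalize (L : ℝ) * (L + 1) = Λ at *
  set a := M * m ^ 2 with ha
  have ha0 : 0 < a := by positivity
  have hΛ0 : 0 < Λ := by linarith
  have hp0 : 0 < rp := by linarith
  have hr0 : ∀ s, 0 < rofs s := fun s => hp0.trans (hr1 s)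
  have hmono := rnTortoise_strictMonoOn hp.le hκ
  have hω2 : 0 < m ^ 2 - ω ^ 2 := by nlinarith
  set e := m ^ 2 - ω ^ 2 with he
  have hrlt : ∀ s t, rofs s < rofs t ↔ s < t := fun s t => by
    rw [← hmono.lt_iff_lt (hr1 s) (hr1 t), hr2, hr2]
  have hinv : ∀ r, rp < r → rofs (rnTortoise rm rp κ r) = r := fun r hr =>
    hmono.injOn (hr1 _) hr (hr2 _)
  have hconc := rnWell_concaveOn (m := m) (c := 0) hM0 hEM hΛ0.le (by linarith)
  simp only [zero_mul, add_zero] at hconc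
  have hxII : rnWell M m E Λ (1 / rofs sII) = e := by
    have := hV sII (hr0 _).ne'; rw [hII] at this; linarith
  have hyII : Λ / rofs sII ≤ z := by
    by_contra! hc
    have h1 : z / Λ < 1 / rofs sII := by
      have := hr0 sII
      rw [div_lt_div_iff₀ hΛ0 this]
      rw [lt_div_iff₀ this] at hc
      linarith
    have := mul_le_mul_of_concaveOn_of_zero hconc (rnWell_zero M m E Λ)
      (by positivity : 0 ≤ z / Λ) h1.le (by have := hr0 sII; positivity) hfar
    rw [hz, hxII, mul_zero] at this
    have : 0 < z / Λ * e := by positivity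
    linarith
  have hyIII : Λ / rofs sIII < Λ / rofs sII := by
    have := (hrlt sII sIII).mpr hlt
    have := hr0 sII
    gcongr
  have hwell : ∀ y, 0 < y → rp < Λ / y →
      -Vpot M m E rofs ω L (rnTortoise rm rp κ (Λ / y)) = rnWell M m E Λ (y / Λ) - e := by
    intro y hy hyp
    rw [hV _ (hr0 _).ne', hinv _ hyp, one_div_div]
  have hpos : ∀ s, 0 < Λ / rofs s := fun s => by have := hr0 s; positivity
  have hfac : ∀ t : ℝ, t * (Λ / (2 * a)) - Λ * e / (2 * a) = (t - e) * (Λ / (2 * a)) := by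
    intro t; ring
  have hzero : ∀ y ∈ Ioi (0 : ℝ) \ Ioo (Λ / rofs sIII) (Λ / rofs sII),
      Real.sqrt ((if y < z then rnWell M m E Λ (y / Λ) * (Λ / (2 * a)) else 0) -
        Λ * e / (2 * a)) * rnTortoiseDeriv M rm rp κ (Λ / y) / y ^ 2 = 0 := by
    rintro y ⟨hy0, hy⟩
    have hy0 : 0 < y := hy0
    suffices h : (if y < z then rnWell M m E Λ (y / Λ) * (Λ / (2 * a)) else 0) -
        Λ * e / (2 * a) ≤ 0 by
      rw [Real.sqrt_eq_zero_of_nonpos h]; simp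
    split_ifs with hyz
    · rw [hfac]
      apply mul_nonpos_of_nonpos_of_nonneg _ (by positivity)
      rcases le_or_gt y (Λ / rofs sIII) with h3 | h3
      · have hge : rofs sIII ≤ Λ / y := by
          rw [le_div_iff₀ (hr0 _)] at h3
          rw [le_div_iff₀ hy0]; linarith
        have hrp : rp < Λ / y := lt_of_lt_of_le (hr1 _) hge
        rw [← hwell y hy0 hrp]
        rcases hge.eq_or_lt with heq | hgt
        · rw [← heq, hr2, hIII, neg_zero]
        · have : sIII < rnTortoise rm rp κ (Λ / y) := by
            rw [← hr2 sIII]; exact hmono (hr1 _) hrp hgt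
          linarith [hout _ this]
      · have h2 : Λ / rofs sII ≤ y := by
          by_contra! hc
          exact hy ⟨h3, hc⟩
        by_contra! hc
        obtain ⟨w, hw1, hw2⟩ := exists_between hyIII
        have hw0 : 0 < w := (hpos _).trans hw1
        have hwr : rofs sII < Λ / w := by
          rw [lt_div_iff₀ (hr0 _)] at hw2
          rw [lt_div_iff₀ hw0]; linarith
        have hwr3 : Λ / w < rofs sIII := by
          rw [div_lt_iff₀ (hr0 _)] at hw1
          rw [div_lt_iff₀ hw0]; linarith
        have hwrp : rp < Λ / w := (hr1 _).trans hwr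
        have hVw := hin (rnTortoise rm rp κ (Λ / w)) ⟨by
          rw [← hr2 sII]; exact hmono (hr1 _) hwrp hwr, by
          rw [← hr2 sIII]; exact hmono hwrp (hr1 _) hwr3⟩
        have hww := hwell w hw0 hwrp
        have hxeq : 1 / rofs sII = (Λ / rofs sII) / Λ := by
          have := hr0 sII; field_simp
        have hmin := hconc.min_le_of_mem_Icc (x := w / Λ) (y := y / Λ) (z := 1 / rofs sII)
          ⟨by positivity, by
            refine le_trans ?_ hfar
            rw [hxeq]; gcongr⟩
          ⟨by positivity, le_trans (by gcongr) hzR⟩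
          ⟨by rw [hxeq]; gcongr, by rw [hxeq]; gcongr⟩
        rw [hxII] at hmin
        rcases min_le_iff.mp hmin with h | h <;> linarith
    · have : 0 < Λ * e / (2 * a) := by positivity
      linarith
  rw [setIntegral_eq_of_subset_of_forall_sdiff_eq_zero measurableSet_Ioi
    (fun y hy => (hpos _).trans hy.1) hzero, ← integral_const_mul,
    integral_tortoise_eq hM hp.le hp0 hκ hΛ0 hr1 hr2 hlt]
  refine setIntegral_congr_fun measurableSet_Ioo ?_
  intro y hy
  have hy0 : 0 < y := (hpos _).trans hy.1
  have hyr : rp < Λ / y := by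
    refine (hr1 sII).trans ?_
    have := hy.2
    rw [lt_div_iff₀ (hr0 _)] at this
    rw [lt_div_iff₀ hy0]; linarith
  have h1 : Real.sqrt (rnWell M m E Λ (y / Λ) - e) = Real.sqrt (2 * a / Λ) *
      Real.sqrt ((rnWell M m E Λ (y / Λ) - e) * (Λ / (2 * a))) := by
    rw [← Real.sqrt_mul (by positivity)]
    congr 1
    field_simp
  have h2 : Real.sqrt (2 * a * Λ) = Real.sqrt (2 * a / Λ) * Λ := by
    rw [show 2 * a * Λ = (2 * a / Λ) * Λ ^ 2 by field_simp, Real.sqrt_mul (by positivity),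
      Real.sqrt_sq hΛ0.le]
  simp only
  rw [if_pos (hy.2.trans_le hyII), hwell y hy0 hyr, hfac, h1, h2]
  ring

lemma scaled_well_bounds {M m E rm rp κ Λ z y : ℝ} (hM0 : 0 < M) (hm0 : 0 < m)
    (hM : rm + rp = 2 * M) (hrm : 0 ≤ rm) (hp : rm < rp) (hEM : E ^ 2 ≤ M ^ 2) (hκ : 0 < κ)
    (hΛ : 1 + m ^ 2 * M ^ 2 ≤ Λ) (hz : rnWell M m E Λ (z / Λ) = 0)
    (hzR : z / Λ ≤ 1 / (12 * M)) (hy : 0 < y) (hyz : y < z) :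
    rnWell M m E Λ (y / Λ) * (Λ / (2 * (M * m ^ 2))) ≤ y ∧
    y - rnWell M m E Λ (y / Λ) * (Λ / (2 * (M * m ^ 2))) ≤ 1 / (M * m ^ 2) * y ^ 2 ∧
    1 / (4 * (M * m ^ 2)) * y * (z - y) ≤
      rnWell M m E Λ (y / Λ) * (Λ / (2 * (M * m ^ 2))) ∧
    1 ≤ rnTortoiseDeriv M rm rp κ (Λ / y) ∧
    rnTortoiseDeriv M rm rp κ (Λ / y) ≤ 1 + 2 * κ⁻¹ * y := by
  set a := M * m ^ 2 with ha
  have ha0 : 0 < a := by positivity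
  have hΛ1 : 1 ≤ Λ := by nlinarith [mul_pos (pow_pos hm0 2) (pow_pos hM0 2)]
  have hΛ0 : 0 < Λ := by linarith
  have hyR : y / Λ ≤ 1 / (12 * M) := le_trans (by gcongr) hzR
  have hr : 12 * M ≤ Λ / y := by
    rw [div_le_div_iff₀ hΛ0 (by positivity)] at hyR
    rw [le_div_iff₀ hy]; linarith
  have hrp : rp < Λ / y := by linarith
  obtain ⟨hb1, hb2⟩ := rnWell_bounds hM0 hEM hΛ (by positivity : 0 ≤ y / Λ) hyR
  have hconc := rnWell_concaveOn (m := m) (c := Λ / 2) hM0 hEM hΛ0.le le_rfl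
  have hl := mul_le_mul_of_concaveOn_of_zero hconc (by simp [rnWell_zero])
    (by positivity : 0 ≤ y / Λ) (by gcongr : y / Λ ≤ z / Λ)
    (div_pos (hy.trans hyz) hΛ0) hzR
  simp only [hz, zero_add] at hl
  generalize rnWell M m E Λ (y / Λ) = w at *
  refine ⟨?_, ?_, ?_, one_le_rnTortoiseDeriv hM hp.le hκ hrp, ?_⟩
  · calc w * (Λ / (2 * a)) ≤ (2 * M * m ^ 2 * (y / Λ)) * (Λ / (2 * a)) := by gcongr
      _ = y := by rw [ha]; field_simp
  · calc y - w * (Λ / (2 * a)) = (2 * M * m ^ 2 * (y / Λ) - w) * (Λ / (2 * a)) := by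
          rw [ha]; field_simp
      _ ≤ (2 * Λ * (y / Λ) ^ 2) * (Λ / (2 * a)) := by gcongr
      _ = 1 / a * y ^ 2 := by field_simp
  · have hz0 : 0 < z := hy.trans hyz
    have h2 : y / Λ * (Λ / 2 * (z / Λ) ^ 2) - z / Λ * (Λ / 2 * (y / Λ) ^ 2) ≤ z / Λ * w := by
      linarith
    have h3 : y / Λ * (Λ / 2 * (z / Λ) ^ 2) - z / Λ * (Λ / 2 * (y / Λ) ^ 2) =
        z / Λ * (y * (z - y) / (2 * Λ)) := by
      field_simp
    rw [h3] at h2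
    have h4 := le_of_mul_le_mul_left h2 (by positivity)
    calc 1 / (4 * a) * y * (z - y) = y * (z - y) / (2 * Λ) * (Λ / (2 * a)) := by
          field_simp; ring
      _ ≤ w * (Λ / (2 * a)) := by gcongr
  · refine (rnTortoiseDeriv_le hM hM0 hrm hp.le hκ hrp (by linarith)).trans ?_
    have : 2 * κ⁻¹ / (Λ / y) = 2 * κ⁻¹ * y / Λ := by field_simp
    rw [this]
    have := div_le_self (by positivity : 0 ≤ 2 * κ⁻¹ * y) hΛ1
    linarith

lemma phase_const_bound {a C D : ℝ} {L : ℕ} (ha : 0 < a) (hL : 1 ≤ L)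
    (hD : |D| ≤ C) :
    |Real.sqrt (2 * a * ((L : ℝ) * (L + 1))) * D / Real.pi| ≤ C * (4 * a + 1) * (L : ℝ) ^ 3 := by
  have hL1 : (1 : ℝ) ≤ L := by exact_mod_cast hL
  rw [abs_div, abs_mul, abs_of_pos Real.pi_pos, abs_of_nonneg (Real.sqrt_nonneg _)]
  have hpi : 1 ≤ Real.pi := by linarith [Real.pi_gt_three]
  have hs : Real.sqrt (2 * a * ((L : ℝ) * (L + 1))) ≤ (4 * a + 1) * (L : ℝ) ^ 3 := by
    apply Real.sqrt_le_iff.mpr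
    refine ⟨by positivity, ?_⟩
    have h2 : (L : ℝ) * (L + 1) ≤ 2 * (L : ℝ) ^ 2 := by nlinarith
    have h6 : (L : ℝ) ^ 2 ≤ (L : ℝ) ^ 6 := pow_le_pow_right₀ hL1 (by norm_num)
    calc 2 * a * ((L : ℝ) * (L + 1)) ≤ 2 * a * (2 * (L : ℝ) ^ 6) :=
          mul_le_mul_of_nonneg_left (by linarith) (by positivity)
      _ ≤ (4 * a + 1) ^ 2 * (L : ℝ) ^ 6 := by
          have : 0 < (L : ℝ) ^ 6 := by positivity
          nlinarith [mul_pos ha this, mul_pos (mul_pos ha ha) this]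
      _ = _ := by ring
  calc Real.sqrt (2 * a * ((L : ℝ) * (L + 1))) * |D| / Real.pi
      ≤ Real.sqrt (2 * a * ((L : ℝ) * (L + 1))) * |D| := div_le_self (by positivity) hpi
    _ ≤ (4 * a + 1) * (L : ℝ) ^ 3 * C := by gcongr
    _ = _ := by ring

/-- Undoing the rescaling `d = Λ e / (2 a)` in the asymptotics of the phase integral. -/
lemma phase_error_unscale {a C D I Λ e : ℝ} (ha : 0 < a) (hΛ : 0 < Λ) (he : 0 < e)
    (hI : |I - Real.pi / (2 * Real.sqrt (Λ * e / (2 * a))) - D| ≤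
      C * Real.sqrt (Λ * e / (2 * a))) :
    |Real.sqrt (2 * a * Λ) * I / Real.pi - a / Real.sqrt e -
      Real.sqrt (2 * a * Λ) * D / Real.pi| ≤ C * (Λ * Real.sqrt e) / Real.pi := by
  have hd : Real.sqrt (2 * a * Λ) * Real.sqrt (Λ * e / (2 * a)) = Λ * Real.sqrt e := by
    rw [← Real.sqrt_mul (by positivity),
      show 2 * a * Λ * (Λ * e / (2 * a)) = Λ ^ 2 * e by field_simp,
      Real.sqrt_mul (by positivity), Real.sqrt_sq hΛ.le]
  have hq : Real.sqrt (2 * a * Λ) / Real.sqrt (Λ * e / (2 * a)) = 2 * a / Real.sqrt e := by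
    rw [← Real.sqrt_div (by positivity),
      show 2 * a * Λ / (Λ * e / (2 * a)) = (2 * a) ^ 2 / e by field_simp,
      Real.sqrt_div (by positivity), Real.sqrt_sq (by positivity)]
  have hs : 0 < Real.sqrt (2 * a * Λ) := by positivity
  have hpi := Real.pi_pos
  have hfac : Real.sqrt (2 * a * Λ) * I / Real.pi - a / Real.sqrt e -
      Real.sqrt (2 * a * Λ) * D / Real.pi =
      Real.sqrt (2 * a * Λ) * (I - Real.pi / (2 * Real.sqrt (Λ * e / (2 * a))) - D) /
        Real.pi := by
    have : a / Real.sqrt e =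
        Real.sqrt (2 * a * Λ) * (Real.pi / (2 * Real.sqrt (Λ * e / (2 * a)))) / Real.pi := by
      rw [show Real.sqrt (2 * a * Λ) * (Real.pi / (2 * Real.sqrt (Λ * e / (2 * a)))) / Real.pi =
        (Real.sqrt (2 * a * Λ) / Real.sqrt (Λ * e / (2 * a))) / 2 by field_simp, hq]
      ring
    rw [this]; ring
  rw [hfac, abs_div, abs_mul, abs_of_pos hs, abs_of_pos hpi, ← hd, mul_left_comm C]
  gcongr

lemma frequency_bounds {m ω l : ℝ} {p : ℕ} (hm : 0 < m) (hp : 2 ≤ p) (hl : 1 < l)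
    (hlm : 1 / m < l) (hω : m - (l ^ p)⁻¹ < ω) (hωm : ω < m) :
    0 < ω ∧ m ^ 2 - ω ^ 2 ≤ 2 * m * (l ^ 2)⁻¹ := by
  have hl0 : 0 < l := one_pos.trans hl
  have hlp : (l ^ p)⁻¹ ≤ (l ^ 2)⁻¹ :=
    inv_anti₀ (by positivity) (pow_le_pow_right₀ hl.le hp)
  have hl2 : (l ^ 2)⁻¹ < m := by
    rw [inv_lt_comm₀ (by positivity) hm, ← one_div]
    exact hlm.trans (lt_self_pow₀ hl one_lt_two)
  have hω0 : 0 < ω := by linarith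
  refine ⟨hω0, ?_⟩
  calc m ^ 2 - ω ^ 2 = (m + ω) * (m - ω) := by ring
    _ ≤ (2 * m) * (l ^ 2)⁻¹ := mul_le_mul (by linarith) (by linarith) (by linarith) (by linarith)

/-- Asymptotics of the phase integral between the two largest turning points:
pi ktilde = int_{sII}^{sIII} sqrt(-V), with ktilde = k + D(L) + O(L^2 / k),
k = M m^2 / sqrt(m^2 - w^2), and |D(L)| <= C L^3, D independent of w. -/
theorem statement14
    (M m E : ℝ) (hM : 0 < M) (hm : 0 < m) (hE : |E| < M)
    (rm rp κ : ℝ)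
    (hrm : rm = M - Real.sqrt (M ^ 2 - E ^ 2))
    (hrp : rp = M + Real.sqrt (M ^ 2 - E ^ 2))
    (hκ : κ = (M * rp - E ^ 2) / rp ^ 3)
    (rofs : ℝ → ℝ)
    (hr1 : ∀ s : ℝ, rp < rofs s)
    (hr2 : ∀ s : ℝ, rofs s + (2 * κ)⁻¹ * Real.log ((rofs s - rm) * (rofs s - rp)) = s) :
    ∀ p : ℕ, 2 ≤ p →
    ∃ C : ℝ, 0 < C ∧ ∃ L₀ : ℕ, ∀ L : ℕ, L₀ ≤ L →
    ∃ D : ℝ, |D| ≤ C * (L : ℝ) ^ 3 ∧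
    ∀ ω : ℝ, m - ((L : ℝ) ^ p)⁻¹ < ω → ω < m →
    ∀ sII sIII : ℝ, sII < sIII →
      Vpot M m E rofs ω L sII = 0 → Vpot M m E rofs ω L sIII = 0 →
      (∀ s ∈ Set.Ioo sII sIII, Vpot M m E rofs ω L s < 0) →
      (∀ s : ℝ, sIII < s → 0 < Vpot M m E rofs ω L s) →
      (∃ η : ℝ, 0 < η ∧ ∀ s ∈ Set.Ioo (sII - η) sII, 0 < Vpot M m E rofs ω L s) →
      |(∫ s in sII..sIII, Real.sqrt (-Vpot M m E rofs ω L s)) / Real.pi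
          - M * m ^ 2 / Real.sqrt (m ^ 2 - ω ^ 2) - D|
        ≤ C * (L : ℝ) ^ 2 * (M * m ^ 2 / Real.sqrt (m ^ 2 - ω ^ 2))⁻¹ := by
  intro p hp
  have hEM : E ^ 2 < M ^ 2 := sq_lt_sq' (abs_lt.mp hE).1 (abs_lt.mp hE).2
  have hsq : Real.sqrt (M ^ 2 - E ^ 2) ^ 2 = M ^ 2 - E ^ 2 := Real.sq_sqrt (by linarith)
  have hs0 : 0 < Real.sqrt (M ^ 2 - E ^ 2) := Real.sqrt_pos.mpr (by linarith)
  have hsum : rm + rp = 2 * M := by rw [hrm, hrp]; ring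
  have hprod : rm * rp = E ^ 2 := by rw [hrm, hrp]; linear_combination -hsq
  have hlt : rm < rp := by rw [hrm, hrp]; linarith
  have hrp0 : 0 < rp := by linarith
  have hrm0 : 0 ≤ rm := by
    by_contra! h
    nlinarith [mul_neg_of_neg_of_pos h hrp0, sq_nonneg E]
  have hrmM : rm < M := by linarith
  have hκ0 : 0 < κ := by
    rw [hκ, ← hprod, show M * rp - rm * rp = (M - rm) * rp by ring]
    have : 0 < M - rm := by linarith
    positivity
  have hE1 : E ^ 2 * (1 / rp) = rm := by rw [← hprod]; field_simp
  set g := (M - E ^ 2 * (1 / rp)) / (16 * M ^ 2) with hg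
  have hg0 : 0 < g := by
    have : 0 < M - E ^ 2 * (1 / rp) := by linarith
    positivity
  set X2 := 2 * (1 / rp) + 6 * M * (1 / rp) ^ 2 with hX2
  have hX20 : 0 < X2 := by positivity
  set δ := min (1 / 2) (g / X2) with hδ
  have hδ0 : 0 < δ := lt_min (by norm_num) (by positivity)
  have hδ1 : δ ≤ 1 / 2 := min_le_left _ _
  have hδ2 : δ * X2 ≤ g := by
    rw [← le_div_iff₀ hX20]; exact min_le_right _ _
  set a := M * m ^ 2 with ha
  have ha0 : 0 < a := by positivity
  set K := 4 * a / δ with hK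
  have hK0 : 0 < K := by positivity
  obtain ⟨C, hC, hcore⟩ := perturbed_phase_integral (C₁ := 1 / a) (C₂ := 2 * κ⁻¹) (Z := K)
    (ρ := 1 / (4 * a)) (d₀ := 2 * m / a) (by positivity) (by positivity) hK0 (by positivity)
    (by positivity)
  refine ⟨C * (4 * a + 1), by positivity, ?_⟩
  obtain ⟨L₀, hL₀⟩ := exists_nat_ge (1 + m ^ 2 * M ^ 2 + 12 * M * K + 1 / m)
  refine ⟨L₀, fun L hL => ?_⟩
  have hLL : 1 + m ^ 2 * M ^ 2 + 12 * M * K + 1 / m ≤ (L : ℝ) := hL₀.trans (by exact_mod_cast hL)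
  have q1 : 0 < m ^ 2 * M ^ 2 := by positivity
  have q2 : 0 < 12 * M * K := by positivity
  have q3 : 0 < 1 / m := by positivity
  have hL1 : (1 : ℝ) < L := by linarith
  have hL1n : 1 ≤ L := by exact_mod_cast hL1.le
  have hLm : 1 / m < (L : ℝ) := by linarith
  have hΛL : (L : ℝ) ≤ (L : ℝ) * (L + 1) := le_mul_of_one_le_right (by linarith) (by linarith)
  have hΛ2 : (L : ℝ) * (L + 1) ≤ 2 * (L : ℝ) ^ 2 := by nlinarith
  have hΛ1 : 1 ≤ (L : ℝ) * (L + 1) := by linarith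
  have hΛ0 : 0 < (L : ℝ) * (L + 1) := by linarith
  have hΛm : 1 + m ^ 2 * M ^ 2 ≤ (L : ℝ) * (L + 1) := by linarith
  have hΛK : 12 * M * K ≤ (L : ℝ) * (L + 1) := by linarith
  have hKR : K / ((L : ℝ) * (L + 1)) ≤ 1 / (12 * M) := by
    rw [div_le_div_iff₀ hΛ0 (by positivity)]; linarith
  obtain ⟨z, haz, hzK, hz⟩ := exists_rnWell_root hM hm hEM.le hΛm hδ0 hδ1 hΛK
  have hz0 : 0 < z := lt_of_lt_of_le ha0 haz
  have hzR : z / ((L : ℝ) * (L + 1)) ≤ 1 / (12 * M) := le_trans (by gcongr) hKR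
  obtain ⟨D, hD, hDd⟩ := hcore z
    (fun y => if y < z then rnWell M m E ((L : ℝ) * (L + 1)) (y / ((L : ℝ) * (L + 1))) *
      ((L : ℝ) * (L + 1) / (2 * a)) else 0)
    (fun y => rnTortoiseDeriv M rm rp κ ((L : ℝ) * (L + 1) / y))
    (Measurable.ite measurableSet_Iio (by unfold rnWell rnLapse; fun_prop) measurable_const)
    (by unfold rnTortoiseDeriv; fun_prop)
    (by rw [one_div, inv_mul_eq_div, one_le_div ha0]; exact haz) hzK
    (fun y hy hyz => by
      simp only [if_pos hyz]
      exact scaled_well_bounds hM hm hsum hrm0 hlt hEM.le hκ0 hΛm hz hzR hy hyz)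
    (fun y hy => if_neg hy.not_gt)
  refine ⟨Real.sqrt (2 * a * ((L : ℝ) * (L + 1))) * D / Real.pi,
    phase_const_bound ha0 hL1n hD, ?_⟩
  rintro ω hω1 hωm sII sIII hss hII hIII hin hout ⟨η, hη, hleft⟩
  obtain ⟨hω0, he1⟩ := frequency_bounds hm hp hL1 hLm hω1 hωm
  have he0 : 0 < m ^ 2 - ω ^ 2 := sub_pos.mpr (pow_lt_pow_left₀ hωm hω0.le two_ne_zero)
  have hd0 : 0 < (L : ℝ) * (L + 1) * (m ^ 2 - ω ^ 2) / (2 * a) := by positivity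
  have hd1 : (L : ℝ) * (L + 1) * (m ^ 2 - ω ^ 2) / (2 * a) ≤ 2 * m / a := by
    calc (L : ℝ) * (L + 1) * (m ^ 2 - ω ^ 2) / (2 * a)
        ≤ (2 * (L : ℝ) ^ 2) * (2 * m * ((L : ℝ) ^ 2)⁻¹) / (2 * a) := by gcongr
      _ = 2 * m / a := by field_simp
  have hfar : 1 / rofs sII ≤ 1 / (12 * M) :=
    (turning_point_far hM hm hsum hlt hprod hκ0 hδ0 hδ1 hδ2 hΛ1 hω0 hωm hr1 hr2 hη hII
      hleft).le.trans hKR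
  rw [phase_integral_eq_scaled hM hm hsum hlt hEM.le hκ0 hΛ1 hω0 hωm hr1 hr2 hss hII hIII hin
    hout hz0 hz hzR hfar]
  refine (phase_error_unscale ha0 hΛ0 he0 (hDd _ hd0 hd1)).trans ?_
  have hpi : 1 ≤ Real.pi := by linarith [Real.pi_gt_three]
  calc C * ((L : ℝ) * (L + 1) * Real.sqrt (m ^ 2 - ω ^ 2)) / Real.pi
      ≤ C * ((L : ℝ) * (L + 1) * Real.sqrt (m ^ 2 - ω ^ 2)) := div_le_self (by positivity) hpi
    _ ≤ C * (2 * (L : ℝ) ^ 2 * Real.sqrt (m ^ 2 - ω ^ 2)) := by gcongr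
    _ = C * (2 * a) * (L : ℝ) ^ 2 * (a / Real.sqrt (m ^ 2 - ω ^ 2))⁻¹ := by
        rw [inv_div]; field_simp
    _ ≤ C * (4 * a + 1) * (L : ℝ) ^ 2 * (a / Real.sqrt (m ^ 2 - ω ^ 2))⁻¹ := by
        gcongr; linarith
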